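/- arXiv:0807.2233 — 3 statements merged into one kernel-verified Lean document; each statement's English description precedes it below -/
import Mathlib

section
/- Eilenberg's inequality: Let X and Y be boundedly compact metric spaces, f : X → Y an L-Lipschitz map, A ⊆ X, and 0 ≤ k, h < ∞. Then the upper integral over Y of H^k(A ∩ f^{-1}(y)) with respect to H^h(y) is at most C · L^h · H^{k+h}(A), where C depends only on k and h. -/
open MeasureTheory Metric Set ENNReal NNReal

/-- The upper (Lebesgue) integral of an arbitrary function with respect to a measure. -/
noncomputable def upperLintegral {Y : Type*} [MeasurableSpace Y] (μ : Measure Y)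
    (f : Y → ℝ≥0∞) : ℝ≥0∞ :=
  ⨅ (g : Y → ℝ≥0∞) (_ : Measurable g) (_ : ∀ y, f y ≤ g y), ∫⁻ y, g y ∂μ


/-- If every finite subfamily of `F` covering `B` contains a disjoint subfamily of total cost at
least `V`, then a finite weighted subfamily covering `B` with multiplicity at least `c` has total
weighted cost at least `c * V`. -/
theorem mul_le_sum_of_disjoint_subfamily {ι Y : Type*} [DecidableEq ι] {F : ι → Set Y}
    {D : ι → ℝ≥0∞} {B : Set Y} {V : ℝ≥0∞}
    (hV : ∀ s : Finset ι, B ⊆ ⋃ i ∈ s, F i →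
      ∃ u ⊆ s, (u : Set ι).PairwiseDisjoint F ∧ V ≤ ∑ i ∈ u, D i)
    (s : Finset ι) (a : ι → ℝ≥0) (c : ℝ≥0)
    (hB : ∀ y ∈ B, c ≤ ∑ i ∈ s, (F i).indicator (fun _ => a i) y) :
    c * V ≤ ∑ i ∈ s, a i * D i := by
  induction hn : s.card using Nat.strong_induction_on generalizing s a c with
  | _ n ih =>
  rcases eq_or_ne c 0 with rfl | hc
  · simp
  have hcov : B ⊆ ⋃ i ∈ s, F i := by
    intro y hy
    by_contra hcon
    simp only [mem_iUnion, not_exists] at hcon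
    have h0 : ∑ i ∈ s, (F i).indicator (fun _ => a i) y = 0 :=
      Finset.sum_eq_zero fun i hi => indicator_of_notMem (hcon i hi) _
    exact hc (le_antisymm (h0 ▸ hB y hy) bot_le)
  obtain ⟨u, hus, hdisj, hVu⟩ := hV s hcov
  by_cases hall : ∀ i ∈ u, c ≤ a i
  · calc (c : ℝ≥0∞) * V ≤ c * ∑ i ∈ u, D i := by gcongr
      _ = ∑ i ∈ u, c * D i := Finset.mul_sum _ _ _
      _ ≤ ∑ i ∈ u, a i * D i := Finset.sum_le_sum fun i hi => by gcongr; exact hall i hi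
      _ ≤ ∑ i ∈ s, a i * D i := Finset.sum_le_sum_of_subset hus
  push Not at hall
  obtain ⟨i₁, hi₁, hci₁⟩ := hall
  obtain ⟨i₀, hi₀, hmin⟩ := u.exists_min_image a ⟨i₁, hi₁⟩
  set τ := a i₀ with hτ
  have hτc : τ ≤ c := (hmin i₁ hi₁).trans hci₁.le
  set a' : ι → ℝ≥0 := fun i => if i ∈ u then a i - τ else a i with ha'
  have haa' : ∀ i, a i = a' i + if i ∈ u then τ else 0 := by
    intro i
    by_cases hi : i ∈ u
    · simp [ha', hi, tsub_add_cancel_of_le (hmin i hi)]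
    · simp [ha', hi]
  have ha'0 : a' i₀ = 0 := by simp [ha', hi₀, hτ]
  have hB' : ∀ y ∈ B, c - τ ≤ ∑ i ∈ s.erase i₀, (F i).indicator (fun _ => a' i) y := by
    intro y hy
    rw [tsub_le_iff_right, Finset.sum_erase _ (by simp [ha'0])]
    refine (hB y hy).trans ?_
    have hsplit : ∀ i ∈ s, (F i).indicator (fun _ => a i) y =
        (F i).indicator (fun _ => a' i) y + if i ∈ u then (F i).indicator (fun _ => τ) y else 0 := by
      intro i _
      by_cases hy : y ∈ F i
      · simpa [hy] using haa' i
      · simp [hy]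
    rw [Finset.sum_congr rfl hsplit, Finset.sum_add_distrib, Finset.sum_ite_mem,
      Finset.inter_eq_right.2 hus]
    gcongr
    by_cases hex : ∃ j ∈ u, y ∈ F j
    · obtain ⟨j, hj, hyj⟩ := hex
      rw [Finset.sum_eq_single_of_mem j hj]
      · exact indicator_le_self _ _ _
      · intro i hi hij
        exact indicator_of_notMem
          (fun hyi => Set.disjoint_left.1 (hdisj hi hj hij) hyi hyj) _
    · push Not at hex
      rw [Finset.sum_eq_zero fun i hi => indicator_of_notMem (hex i hi) _]
      exact bot_le
  have key := ih _ (hn ▸ Finset.card_erase_lt_of_mem (hus hi₀)) (s.erase i₀) a' (c - τ) hB' rfl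
  rw [Finset.sum_erase _ (by simp [ha'0])] at key
  calc (c : ℝ≥0∞) * V = ((c - τ : ℝ≥0) : ℝ≥0∞) * V + τ * V := by
        rw [← add_mul, ← ENNReal.coe_add, tsub_add_cancel_of_le hτc]
    _ ≤ ∑ i ∈ s, a' i * D i + τ * ∑ i ∈ u, D i := by gcongr
    _ = ∑ i ∈ s, a i * D i := by
        have : ∀ i ∈ s, (a i : ℝ≥0∞) * D i = a' i * D i + if i ∈ u then τ * D i else 0 := by
          intro i _
          rw [haa' i, ENNReal.coe_add, add_mul]
          split_ifs <;> simp
        rw [Finset.sum_congr rfl this, Finset.sum_add_distrib, Finset.sum_ite_mem,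
          Finset.inter_eq_right.2 hus, Finset.mul_sum]

theorem sum_range_eq_sum_sum_Ico {M : Type*} [AddCommMonoid M] {I : ℕ → ℕ} (hI : Monotone I)
    (h0 : I 0 = 0) (f : ℕ → M) (n : ℕ) :
    ∑ i ∈ Finset.range (I n), f i = ∑ j ∈ Finset.range n, ∑ i ∈ Finset.Ico (I j) (I (j + 1)), f i := by
  induction n with
  | zero => simp [h0]
  | succ n ih =>
    rw [Finset.sum_range_succ, ← ih, Finset.range_eq_Ico, Finset.range_eq_Ico,
      Finset.sum_Ico_consecutive _ (Nat.zero_le _) (hI n.le_succ)]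

/-- The tails of a convergent series in `ℝ≥0∞` can be made to decay geometrically along a
subsequence that starts at `0`. -/
theorem exists_strictMono_tsum_tail_le {w : ℕ → ℝ≥0∞} (hw : ∑' i, w i ≠ ∞) :
    ∃ I : ℕ → ℕ, StrictMono I ∧ I 0 = 0 ∧
      ∀ j, ∑' i, w (i + I j) ≤ (4⁻¹ : ℝ≥0∞) ^ j * ∑' i, w i := by
  have hstep : ∀ j m : ℕ, ∃ n, m < n ∧
      ∑' i, w (i + n) ≤ (4⁻¹ : ℝ≥0∞) ^ (j + 1) * ∑' i, w i := by
    intro j m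
    rcases eq_or_ne (∑' i, w i) 0 with h0 | h0
    · refine ⟨m + 1, m.lt_succ_self, ?_⟩
      rw [ENNReal.tsum_eq_zero] at h0
      simp [h0]
    · have hpos : 0 < (4⁻¹ : ℝ≥0∞) ^ (j + 1) * ∑' i, w i :=
        pos_iff_ne_zero.2 (mul_ne_zero (pow_ne_zero _ (by simp)) h0)
      obtain ⟨n, hn, hmn⟩ := (((ENNReal.tendsto_sum_nat_add w hw).eventually_lt_const hpos).and
        (Filter.eventually_gt_atTop m)).exists
      exact ⟨n, hmn, hn.le⟩
  choose next hnext_gt hnext_le using hstep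
  refine ⟨fun n => Nat.rec 0 next n, strictMono_nat_of_lt_succ fun n => hnext_gt n _, rfl, ?_⟩
  rintro (_ | j)
  · simp
  · exact hnext_le j _

/-- Countable version of `mul_le_sum_of_disjoint_subfamily` for outer measures. -/
theorem mul_le_tsum_of_disjoint_subfamily {Y : Type*} (ν : OuterMeasure Y) {F : ℕ → Set Y}
    {D : ℕ → ℝ≥0∞} {B : Set Y}
    (hν : ∀ B' ⊆ B, ∀ s : Finset ℕ, B' ⊆ ⋃ i ∈ s, F i →
      ∃ u ⊆ s, (u : Set ℕ).PairwiseDisjoint F ∧ ν B' ≤ ∑ i ∈ u, D i)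
    (a : ℕ → ℝ≥0) (c : ℝ≥0)
    (hB : ∀ y ∈ B, (c : ℝ≥0∞) < ∑' i, (F i).indicator (fun _ => (a i : ℝ≥0∞)) y) :
    c * ν B ≤ 4 * ∑' i, a i * D i := by
  rcases eq_or_ne (∑' i, a i * D i) ∞ with htop | htop
  · simp [htop]
  obtain ⟨I, hI, hI0, htail⟩ := exists_strictMono_tsum_tail_le htop
  set M := ∑' i, a i * D i with hM
  set P : ℕ → Set Y := fun j => {y ∈ B | c * (1 / 2) ^ (j + 1) ≤
    ∑ i ∈ Finset.Ico (I j) (I (j + 1)), (F i).indicator (fun _ => a i) y} with hP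
  have hPν : ∀ j, c * ν (P j) ≤ 2 * ((2⁻¹ : ℝ≥0∞) ^ j * M) := by
    intro j
    have h1 := mul_le_sum_of_disjoint_subfamily (hν (P j) (sep_subset _ _))
      (Finset.Ico (I j) (I (j + 1))) a (c * (1 / 2) ^ (j + 1)) fun y hy => hy.2
    have h2 : ∑ i ∈ Finset.Ico (I j) (I (j + 1)), a i * D i ≤ (4⁻¹ : ℝ≥0∞) ^ j * M := by
      refine le_trans ?_ (htail j)
      rw [Finset.sum_Ico_eq_sum_range]
      simp_rw [add_comm (I j)]
      exact ENNReal.sum_le_tsum _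
    have h3 := h1.trans h2
    have hhalf_coe : ((c * (1 / 2) ^ (j + 1) : ℝ≥0) : ℝ≥0∞) = c * (2⁻¹ : ℝ≥0∞) ^ (j + 1) := by
      push_cast
      rw [one_div]
    rw [hhalf_coe] at h3
    have hcancel : (2 : ℝ≥0∞) ^ (j + 1) * (2⁻¹ : ℝ≥0∞) ^ (j + 1) = 1 := by
      rw [← mul_pow, ENNReal.mul_inv_cancel two_ne_zero ofNat_ne_top, one_pow]
    have hquarter : (2 : ℝ≥0∞) * (4⁻¹ : ℝ≥0∞) = 2⁻¹ := by
      rw [show (4 : ℝ≥0∞) = 2 * 2 by norm_num, ENNReal.mul_inv (by simp) (by simp), ← mul_assoc,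
        ENNReal.mul_inv_cancel two_ne_zero ofNat_ne_top, one_mul]
    calc c * ν (P j) = 2 ^ (j + 1) * (2⁻¹ : ℝ≥0∞) ^ (j + 1) * (c * ν (P j)) := by
          rw [hcancel, one_mul]
      _ = 2 ^ (j + 1) * (c * (2⁻¹ : ℝ≥0∞) ^ (j + 1) * ν (P j)) := by ring
      _ ≤ 2 ^ (j + 1) * ((4⁻¹ : ℝ≥0∞) ^ j * M) := by gcongr
      _ = 2 * ((2 * 4⁻¹) ^ j * M) := by rw [mul_pow]; ring
      _ = 2 * ((2⁻¹ : ℝ≥0∞) ^ j * M) := by rw [hquarter]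
  have hcover : B ⊆ ⋃ j, P j := by
    intro y hy
    by_contra hcon
    simp only [hP, mem_iUnion, mem_sep_iff, not_exists, not_and, not_le] at hcon
    refine (hB y hy).not_ge (ENNReal.tsum_le_of_sum_range_le fun n => ?_)
    have hcoe : ∀ i, (F i).indicator (fun _ => (a i : ℝ≥0∞)) y =
        (((F i).indicator (fun _ => a i) y : ℝ≥0) : ℝ≥0∞) := by
      intro i
      by_cases hi : y ∈ F i <;> simp [hi]
    simp_rw [hcoe]
    rw [← ENNReal.ofNNReal_finsetSum, ENNReal.coe_le_coe]
    calc ∑ i ∈ Finset.range n, (F i).indicator (fun _ => a i) y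
        ≤ ∑ i ∈ Finset.range (I n), (F i).indicator (fun _ => a i) y :=
          Finset.sum_le_sum_of_subset (Finset.range_mono (hI.le_apply))
      _ = ∑ j ∈ Finset.range n, ∑ i ∈ Finset.Ico (I j) (I (j + 1)),
            (F i).indicator (fun _ => a i) y := sum_range_eq_sum_sum_Ico hI.monotone hI0 _ n
      _ ≤ ∑ j ∈ Finset.range n, c * (1 / 2) ^ (j + 1) :=
          Finset.sum_le_sum fun j _ => (hcon j hy).le
      _ ≤ c := by
          have : ∑ j ∈ Finset.range n, c * (1 / 2) ^ (j + 1) + c * (1 / 2) ^ n = c := by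
            induction n with
            | zero => simp
            | succ n ih =>
              rw [Finset.sum_range_succ]
              refine Eq.trans ?_ ih
              rw [add_assoc, ← mul_add, pow_succ, ← mul_add, add_halves, mul_one]
          exact le_of_le_of_eq le_self_add this
  calc (c : ℝ≥0∞) * ν B ≤ c * ∑' j, ν (P j) := by
        gcongr
        exact (ν.mono hcover).trans (measure_iUnion_le _)
    _ = ∑' j, c * ν (P j) := ENNReal.tsum_mul_left.symm
    _ ≤ ∑' j, 2 * ((2⁻¹ : ℝ≥0∞) ^ j * M) := ENNReal.tsum_le_tsum hPν
    _ = 4 * M := by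
        rw [ENNReal.tsum_mul_left, ENNReal.tsum_mul_right, ENNReal.tsum_geometric,
          ENNReal.one_sub_inv_two, inv_inv, ← mul_assoc]
        norm_num

/-- A finite cover of `B` by sets of diameter at most `r'` contains a disjoint subfamily whose
five-fold enlargements cover `B`. -/
theorem exists_disjoint_subfamily_pre_le {Y : Type*} [MetricSpace Y] {ι : Type*} {h : ℝ}
    (hh : 0 ≤ h) {r r' : ℝ≥0∞} (hr' : r' ≠ ∞) (hr : 5 * r' ≤ r) {F : ι → Set Y}
    (hF : ∀ i, ediam (F i) ≤ r') {B : Set Y} (s : Finset ι) (hB : B ⊆ ⋃ i ∈ s, F i) :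
    ∃ u ⊆ s, (u : Set ι).PairwiseDisjoint F ∧ (∀ i ∈ u, (F i ∩ B).Nonempty) ∧
      OuterMeasure.mkMetric'.pre (fun t : Set Y => ediam t ^ h) r B ≤
        ∑ i ∈ u, 5 ^ h * ediam (F i) ^ h := by
  classical
  have hfin : ∀ i, ediam (F i) ≠ ∞ := fun i => ne_top_of_le_ne_top hr' (hF i)
  obtain ⟨u, hu, hdisj, hcov⟩ := Vitali.exists_disjoint_subfamily_covering_enlargement F
    {i | i ∈ s ∧ (F i ∩ B).Nonempty} (fun i => (ediam (F i)).toReal) 2 one_lt_two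
    (fun _ _ => toReal_nonneg) r'.toReal (fun i _ => ENNReal.toReal_mono hr' (hF i))
    (fun i hi => hi.2.mono inter_subset_left)
  lift u to Finset ι using s.finite_toSet.subset fun i hi => (hu hi).1
  refine ⟨u, fun i hi => (hu hi).1, hdisj, fun i hi => (hu hi).2, ?_⟩
  set G : ι → Set Y := fun b => ⋃ (i) (_ : (F i ∩ F b).Nonempty ∧
    (ediam (F i)).toReal ≤ 2 * (ediam (F b)).toReal), F i with hG
  have hGdiam : ∀ b, ediam (G b) ≤ 5 * ediam (F b) := by
    intro b
    have hle : ∀ i, (ediam (F i)).toReal ≤ 2 * (ediam (F b)).toReal →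
        ediam (F i) ≤ 2 * ediam (F b) := by
      intro i hi
      rw [← ENNReal.toReal_le_toReal (hfin i) (ENNReal.mul_ne_top ofNat_ne_top (hfin b)),
        ENNReal.toReal_mul]
      simpa using hi
    refine ediam_le fun x hx y hy => ?_
    simp only [hG, mem_iUnion, exists_prop] at hx hy
    obtain ⟨i, ⟨⟨p, hpi, hpb⟩, hi⟩, hxi⟩ := hx
    obtain ⟨j, ⟨⟨q, hqj, hqb⟩, hj⟩, hyj⟩ := hy
    calc edist x y ≤ edist x p + edist p q + edist q y := edist_triangle4 _ _ _ _
      _ ≤ 2 * ediam (F b) + ediam (F b) + 2 * ediam (F b) := by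
          gcongr
          · exact (edist_le_ediam_of_mem hxi hpi).trans (hle i hi)
          · exact edist_le_ediam_of_mem hpb hqb
          · exact (edist_le_ediam_of_mem hqj hyj).trans (hle j hj)
      _ = 5 * ediam (F b) := by ring
  have hBG : B ⊆ ⋃ b ∈ u, G b := by
    intro y hy
    obtain ⟨i, hi, hyi⟩ := mem_iUnion₂.1 (hB hy)
    obtain ⟨b, hb, hib, hdiam⟩ := hcov i ⟨hi, y, hyi, hy⟩
    exact mem_iUnion₂.2 ⟨b, hb, mem_iUnion₂.2 ⟨i, ⟨hib, hdiam⟩, hyi⟩⟩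
  refine (measure_mono hBG).trans ((measure_biUnion_finset_le _ _).trans
    (Finset.sum_le_sum fun b _ => ?_))
  rw [← ENNReal.mul_rpow_of_nonneg _ _ hh]
  refine (OuterMeasure.mkMetric'.pre_le ((hGdiam b).trans ?_)).trans
    (ENNReal.rpow_le_rpow (hGdiam b) hh)
  exact (mul_le_mul_right (hF b) 5).trans hr

open Classical in
/-- A weighted covering of `B` with multiplicity more than `c` controls `c` times the Hausdorff
premeasure of `B`. -/
theorem mul_pre_le_tsum {Y : Type*} [MetricSpace Y] {h : ℝ}
    (hh : 0 ≤ h) {r r' : ℝ≥0∞} (hr' : r' ≠ ∞) (hr : 5 * r' ≤ r) {F : ℕ → Set Y}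
    (hF : ∀ i, ediam (F i) ≤ r') {B : Set Y} (a : ℕ → ℝ≥0) (c : ℝ≥0)
    (hB : ∀ y ∈ B, (c : ℝ≥0∞) < ∑' i, (F i).indicator (fun _ => (a i : ℝ≥0∞)) y) :
    c * OuterMeasure.mkMetric'.pre (fun t : Set Y => ediam t ^ h) r B ≤
      4 * 5 ^ h * ∑' i, if (F i ∩ B).Nonempty then a i * ediam (F i) ^ h else 0 := by
  have key := mul_le_tsum_of_disjoint_subfamily
    (OuterMeasure.mkMetric'.pre (fun t : Set Y => ediam t ^ h) r) (F := F) (B := B)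
    (D := fun i => if (F i ∩ B).Nonempty then 5 ^ h * ediam (F i) ^ h else 0) (fun B' hB' s hs => by
      obtain ⟨u, hus, hdisj, hmeet, hle⟩ := exists_disjoint_subfamily_pre_le hh hr' hr hF s hs
      refine ⟨u, hus, hdisj, hle.trans_eq (Finset.sum_congr rfl fun i hi => ?_)⟩
      rw [if_pos ((hmeet i hi).mono (inter_subset_inter_right _ hB'))]) a c hB
  refine key.trans_eq ?_
  rw [mul_assoc, ← ENNReal.tsum_mul_left (a := 5 ^ h)]
  refine congrArg (4 * ·) (tsum_congr fun i => ?_)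
  split_ifs
  · ring
  · simp

open Filter Topology

theorem hausdorffMeasure_eq_mkMetric' {Y : Type*} [MetricSpace Y] [MeasurableSpace Y] [BorelSpace Y]
    (d : ℝ) (s : Set Y) :
    μH[d] s = OuterMeasure.mkMetric' (fun t : Set Y => ediam t ^ d) s := by
  rw [Measure.hausdorffMeasure, ← OuterMeasure.coe_mkMetric]
  rfl

open Classical in
/-- A sequence of weighted coverings of `K` by sets of diameter tending to `0`, with multiplicity
asymptotically at least `x`, controls `x` times the Hausdorff measure of `K`. -/
theorem mul_hausdorffMeasure_le_liminf {Y : Type*} [MetricSpace Y] [MeasurableSpace Y]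
    [BorelSpace Y] {h : ℝ} (hh : 0 ≤ h) {F : ℕ → ℕ → Set Y} {a : ℕ → ℕ → ℝ≥0} {r : ℕ → ℝ≥0∞}
    (hr : ∀ n, r n ≠ ∞) (hr0 : Tendsto r atTop (𝓝 0)) (hF : ∀ n i, ediam (F n i) ≤ r n)
    {K : Set Y} {x : ℝ≥0∞}
    (hK : ∀ y ∈ K, x ≤ liminf (fun n => ∑' i, (F n i).indicator (fun _ => (a n i : ℝ≥0∞)) y) atTop) :
    x * μH[h] K ≤ liminf (fun n => 4 * 5 ^ h *
      ∑' i, if (F n i ∩ K).Nonempty then a n i * ediam (F n i) ^ h else 0) atTop := by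
  refine ENNReal.mul_le_of_forall_lt fun c hcx b hb => ?_
  lift c to ℝ≥0 using hcx.ne_top
  refine le_trans (by gcongr) (?_ : (c : ℝ≥0∞) * μH[h] K ≤ _)
  set E : ℕ → Set Y := fun m => {y ∈ K | ∀ n ≥ m,
    (c : ℝ≥0∞) < ∑' i, (F n i).indicator (fun _ => (a n i : ℝ≥0∞)) y} with hE
  have hEmono : Monotone E := fun m m' hm y hy => ⟨hy.1, fun n hn => hy.2 n (hm.trans hn)⟩
  have hKE : K = ⋃ m, E m := by
    refine Subset.antisymm (fun y hy => ?_) (iUnion_subset fun m => sep_subset _ _)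
    obtain ⟨m, hm⟩ := eventually_atTop.1 (eventually_lt_of_lt_liminf (hcx.trans_le (hK y hy)))
    exact mem_iUnion.2 ⟨m, hy, hm⟩
  nth_rewrite 1 [hKE]
  rw [hEmono.measure_iUnion, ENNReal.mul_iSup]
  refine iSup_le fun m => ?_
  rw [hausdorffMeasure_eq_mkMetric']
  refine le_of_tendsto' (ENNReal.Tendsto.const_mul (OuterMeasure.mkMetric'.tendsto_pre_nat _ (E m))
    (Or.inr coe_ne_top)) fun p => ?_
  refine le_liminf_of_le (by isBoundedDefault) ?_
  have h5 : Tendsto (fun n => 5 * r n) atTop (𝓝 0) := by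
    simpa using ENNReal.Tendsto.const_mul hr0 (Or.inr (by simp : (5 : ℝ≥0∞) ≠ ∞))
  filter_upwards [eventually_ge_atTop m, h5.eventually_lt_const
    (ENNReal.inv_pos.2 (ENNReal.natCast_ne_top p))] with n hnm hn
  refine (mul_pre_le_tsum hh (hr n) hn.le (hF n) (a n) c fun y hy => hy.2 n hnm).trans ?_
  gcongr with i
  by_cases hne : (F n i ∩ E m).Nonempty
  · rw [if_pos hne, if_pos (hne.mono (inter_subset_inter_right _ (sep_subset _ _)))]
  · rw [if_neg hne]
    exact bot_le

theorem finsetSum_liminf_le_liminf_finsetSum {ι : Type*} (s : Finset ι) (u : ι → ℕ → ℝ≥0∞) :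
    ∑ x ∈ s, liminf (u x) atTop ≤ liminf (fun n => ∑ x ∈ s, u x n) atTop := by
  simp_rw [liminf_eq_iSup_iInf_of_nat]
  rw [ENNReal.finsetSum_iSup_of_monotone fun x m m' hm =>
    biInf_mono fun n (hn : m' ≤ n) => hm.trans hn]
  exact iSup_mono fun m => le_iInf₂ fun n hn => Finset.sum_le_sum fun x _ => iInf₂_le n hn

open Classical in
/-- If the diameters of the sets `F n i` tend to `0` uniformly in `i`, then for large `n` no set
`F n i` meets two members of a finite disjoint family of compact sets. -/
theorem eventually_sum_tsum_le {Y ι : Type*} [MetricSpace Y] {F : ℕ → ℕ → Set Y} {r : ℕ → ℝ≥0∞}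
    (hr0 : Tendsto r atTop (𝓝 0)) (hF : ∀ n i, ediam (F n i) ≤ r n) (w : ℕ → ℕ → ℝ≥0∞)
    (s : Finset ι) {K : ι → Set Y} (hK : ∀ x, IsCompact (K x))
    (hdisj : Pairwise fun x x' => Disjoint (K x) (K x')) :
    ∀ᶠ n in atTop, ∑ x ∈ s, ∑' i, (if (F n i ∩ K x).Nonempty then w n i else 0) ≤
      ∑' i, if (F n i).Nonempty then w n i else 0 := by
  have hsep : ∀ᶠ n in atTop, ∀ x ∈ s, ∀ x' ∈ s, x ≠ x' → ∀ i, (F n i ∩ K x).Nonempty →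
      ¬ (F n i ∩ K x').Nonempty := by
    simp only [eventually_all_finset]
    intro x _ x' _
    by_cases hxx : x = x'
    · simp [hxx]
    obtain ⟨δ, hδ, hlt⟩ := exists_pos_forall_lt_edist (hK x) (hK x').isClosed (hdisj hxx)
    filter_upwards [hr0.eventually_lt_const (ENNReal.coe_pos.2 hδ)] with n hn _ i
    rintro ⟨p, hpF, hpK⟩ ⟨q, hqF, hqK⟩
    exact (hlt p hpK q hqK).not_ge
      (((edist_le_ediam_of_mem hpF hqF).trans (hF n i)).trans hn.le)
  filter_upwards [hsep] with n hn
  rw [← Summable.tsum_finsetSum fun _ _ => ENNReal.summable]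
  refine ENNReal.tsum_le_tsum fun i => ?_
  by_cases hex : ∃ x ∈ s, (F n i ∩ K x).Nonempty
  · obtain ⟨x, hx, hxi⟩ := hex
    rw [Finset.sum_eq_single_of_mem x hx fun x' hx' hne => if_neg (hn x hx x' hx' hne.symm i hxi),
      if_pos hxi, if_pos (hxi.mono inter_subset_left)]
  · push Not at hex
    rw [Finset.sum_eq_zero fun x hx => if_neg (not_nonempty_iff_eq_empty.2 (hex x hx))]
    exact bot_le

open Classical in
/-- A Fatou type inequality for weighted coverings and the Hausdorff measure. -/
theorem lintegral_liminf_tsum_le {Y : Type*} [MetricSpace Y] [MeasurableSpace Y]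
    [BorelSpace Y] [ProperSpace Y] {h : ℝ} (hh : 0 ≤ h) {F : ℕ → ℕ → Set Y} {a : ℕ → ℕ → ℝ≥0}
    {r : ℕ → ℝ≥0∞} (hr : ∀ n, r n ≠ ∞) (hr0 : Tendsto r atTop (𝓝 0))
    (hF : ∀ n i, ediam (F n i) ≤ r n) :
    ∫⁻ y, liminf (fun n => ∑' i, (F n i).indicator (fun _ => (a n i : ℝ≥0∞)) y) atTop ∂μH[h] ≤
      liminf (fun n => 4 * 5 ^ h *
        ∑' i, if (F n i).Nonempty then a n i * ediam (F n i) ^ h else 0) atTop := by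
  set Λ := liminf (fun n => 4 * 5 ^ h *
        ∑' i, if (F n i).Nonempty then a n i * ediam (F n i) ^ h else 0) atTop with hΛ
  rcases eq_or_ne Λ ∞ with htop | htop
  · simp [htop]
  rw [lintegral_eq_nnreal]
  refine iSup₂_le fun φ hφ => ?_
  rw [SimpleFunc.map_lintegral]
  have hlevel : ∀ x : ℝ≥0, ∀ K ⊆ φ ⁻¹' {x}, (x : ℝ≥0∞) * μH[h] K ≤ liminf (fun n => 4 * 5 ^ h *
      ∑' i, if (F n i ∩ K).Nonempty then a n i * ediam (F n i) ^ h else 0) atTop := by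
    intro x K hK
    refine mul_hausdorffMeasure_le_liminf hh hr hr0 hF fun y hy => ?_
    have hxy : φ y = x := hK hy
    exact hxy ▸ hφ y
  have hfin : ∀ x : ℝ≥0, x ≠ 0 → μH[h] (φ ⁻¹' {x}) ≠ ∞ := by
    intro x hx hinf
    have hle : (x : ℝ≥0∞) * μH[h] (φ ⁻¹' {x}) ≤ Λ := by
      refine (hlevel x _ Subset.rfl).trans (liminf_le_liminf (Eventually.of_forall fun n => ?_))
      gcongr with i
      by_cases hne : (F n i ∩ φ ⁻¹' {x}).Nonempty
      · rw [if_pos hne, if_pos (hne.mono inter_subset_left)]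
      · rw [if_neg hne]
        exact bot_le
    rw [hinf, ENNReal.mul_top (by simpa using hx)] at hle
    exact htop (top_le_iff.1 hle)
  have happrox : ∀ ε : ℝ≥0∞, ε ≠ 0 → ∑ x ∈ φ.range, (x : ℝ≥0∞) * μH[h] (φ ⁻¹' {x}) ≤
      Λ + (∑ x ∈ φ.range, (x : ℝ≥0∞)) * ε := by
    intro ε hε
    have hex : ∀ x : ℝ≥0, ∃ K ⊆ φ ⁻¹' {x}, IsCompact K ∧
        (x : ℝ≥0∞) * μH[h] (φ ⁻¹' {x}) ≤ x * μH[h] K + x * ε := by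
      intro x
      rcases eq_or_ne x 0 with rfl | hx
      · exact ⟨∅, empty_subset _, isCompact_empty, by simp⟩
      have : IsFiniteMeasure ((μH[h] : Measure Y).restrict (φ ⁻¹' {x})) :=
        isFiniteMeasure_restrict.2 (hfin x hx)
      obtain ⟨K, hKsub, hKc, hKlt⟩ := (φ.measurableSet_fiber x).exists_isCompact_lt_add
        (μ := (μH[h] : Measure Y).restrict (φ ⁻¹' {x})) (measure_ne_top _ _) hε
      rw [Measure.restrict_apply_self, Measure.restrict_eq_self _ hKsub] at hKlt
      refine ⟨K, hKsub, hKc, ?_⟩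
      rw [← mul_add]
      gcongr
    choose K hKsub hKc hKle using hex
    have hdisj : Pairwise fun x x' => Disjoint (K x) (K x') := fun x x' hne =>
      (Disjoint.preimage φ (disjoint_singleton.2 hne)).mono (hKsub x) (hKsub x')
    calc ∑ x ∈ φ.range, (x : ℝ≥0∞) * μH[h] (φ ⁻¹' {x})
        ≤ ∑ x ∈ φ.range, ((x : ℝ≥0∞) * μH[h] (K x) + x * ε) :=
          Finset.sum_le_sum fun x _ => hKle x
      _ = ∑ x ∈ φ.range, (x : ℝ≥0∞) * μH[h] (K x) + (∑ x ∈ φ.range, (x : ℝ≥0∞)) * ε := by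
          rw [Finset.sum_add_distrib, Finset.sum_mul]
      _ ≤ Λ + (∑ x ∈ φ.range, (x : ℝ≥0∞)) * ε := by
          gcongr
          refine (Finset.sum_le_sum fun x _ => hlevel x (K x) (hKsub x)).trans
            ((finsetSum_liminf_le_liminf_finsetSum _ _).trans (liminf_le_liminf ?_))
          filter_upwards [eventually_sum_tsum_le hr0 hF (fun n i => a n i * ediam (F n i) ^ h)
            φ.range hKc hdisj] with n hn
          rw [← Finset.mul_sum]
          gcongr
  have hlim : Tendsto (fun n : ℕ => Λ + (∑ x ∈ φ.range, (x : ℝ≥0∞)) * (n : ℝ≥0∞)⁻¹) atTop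
      (𝓝 (Λ + (∑ x ∈ φ.range, (x : ℝ≥0∞)) * 0)) :=
    tendsto_const_nhds.add (ENNReal.Tendsto.const_mul ENNReal.tendsto_inv_nat_nhds_zero
      (Or.inr (by simp [ENNReal.sum_eq_top])))
  rw [mul_zero, add_zero] at hlim
  exact ge_of_tendsto' hlim fun n => happrox _ (by simp)

open Classical in
/-- Covers of `A` by sets of small diameter that are nearly optimal for the Hausdorff measure. -/
theorem exists_cover_tsum_le {X : Type*} [MetricSpace X] [MeasurableSpace X] [BorelSpace X]
    (d : ℝ) {A : Set X} (hA : μH[d] A ≠ ∞) {ε : ℝ≥0∞} (hε : 0 < ε) :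
    ∃ t : ℕ → Set X, A ⊆ ⋃ i, t i ∧ (∀ i, ediam (t i) ≤ ε) ∧
      ∑' i, (if (t i).Nonempty then ediam (t i) ^ d else 0) ≤ μH[d] A + ε := by
  have hlt : (⨅ (t : ℕ → Set X) (_ : A ⊆ ⋃ n, t n) (_ : ∀ n, ediam (t n) ≤ ε),
      ∑' n, ⨆ _ : (t n).Nonempty, ediam (t n) ^ d) < μH[d] A + ε := by
    refine lt_of_le_of_lt ?_ (ENNReal.lt_add_right hA hε.ne')
    rw [Measure.hausdorffMeasure_apply]
    exact le_iSup₂_of_le ε hε le_rfl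
  simp only [iInf_lt_iff] at hlt
  obtain ⟨t, hAt, htε, hsum⟩ := hlt
  refine ⟨t, hAt, htε, le_of_eq_of_le (tsum_congr fun i => ?_) hsum.le⟩
  split_ifs with hne <;> simp [hne]

theorem upperLintegral_le_lintegral {Y : Type*} [MeasurableSpace Y] {μ : Measure Y}
    {f g : Y → ℝ≥0∞} (hg : Measurable g) (hfg : ∀ y, f y ≤ g y) :
    upperLintegral μ f ≤ ∫⁻ y, g y ∂μ :=
  iInf_le_of_le g (iInf₂_le_of_le hg hfg le_rfl)

/-- A fibre of `f` inside `A` has Hausdorff measure at most the lower limit of the sums associated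
with fine covers of `A`. -/
theorem hausdorffMeasure_fiber_le_liminf {X Y : Type*} [MetricSpace X] [MeasurableSpace X]
    [BorelSpace X] {k : ℝ} {A : Set X} {f : X → Y} {t : ℕ → ℕ → Set X}
    {F : ℕ → ℕ → Set Y} (htF : ∀ n i, f '' t n i ⊆ F n i) (hA : ∀ n, A ⊆ ⋃ i, t n i)
    (ht : ∀ n i, ediam (t n i) ≤ (n : ℝ≥0∞)⁻¹) (y : Y) :
    μH[k] (A ∩ f ⁻¹' {y}) ≤
      liminf (fun n => ∑' i, (F n i).indicator (fun _ => ediam (t n i) ^ k) y) atTop := by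
  rw [hausdorffMeasure_eq_mkMetric',
    ← (OuterMeasure.mkMetric'.tendsto_pre_nat _ (A ∩ f ⁻¹' {y})).liminf_eq]
  refine liminf_le_liminf (Eventually.of_forall fun n => ?_)
  have hcov : A ∩ f ⁻¹' {y} ⊆ ⋃ i, t n i ∩ f ⁻¹' {y} := by
    rw [← iUnion_inter]
    exact inter_subset_inter_left _ (hA n)
  refine (measure_mono hcov).trans ((measure_iUnion_le _).trans
    (ENNReal.tsum_le_tsum fun i => ?_))
  by_cases hy : y ∈ F n i
  · rw [indicator_of_mem hy]
    exact (measure_mono inter_subset_left).trans (OuterMeasure.mkMetric'.pre_le (ht n i))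
  · have hempty : t n i ∩ f ⁻¹' {y} = ∅ := by
      refine eq_empty_of_forall_notMem fun x hx => hy ?_
      have hxy : f x = y := hx.2
      exact hxy ▸ htF n i (mem_image_of_mem f hx.1)
    simp [hempty]

/-- The upper integral of fibre measures vanishes for constant maps when `0 < h`. -/
theorem upperLintegral_fiber_eq_zero {X Y : Type*} [MetricSpace X] [MeasurableSpace X]
    [BorelSpace X] [MetricSpace Y] [MeasurableSpace Y] [BorelSpace Y] {k h : ℝ} (hh : 0 < h)
    {f : X → Y} (hf : LipschitzWith 0 f) (A : Set X) :
    upperLintegral (μH[h] : Measure Y) (fun y => μH[k] (A ∩ f ⁻¹' {y})) = 0 := by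
  rw [← nonpos_iff_eq_zero]
  have : NullSingletonClass (μH[h] : Measure Y) := Measure.nullSingletonClass_hausdorff Y hh
  have hrange : (range f).Subsingleton := by
    rintro _ ⟨x, rfl⟩ _ ⟨x', rfl⟩
    simpa using hf x x'
  have hnull : μH[h] (range f) = 0 := hrange.measure_zero _
  have hmeas : MeasurableSet (range f) := hrange.measurableSet
  refine (upperLintegral_le_lintegral (g := (range f).indicator fun _ => ∞)
    (measurable_const.indicator hmeas) fun y => ?_).trans ?_
  · by_cases hy : y ∈ range f
    · simp [hy]
    · rw [preimage_singleton_eq_empty.2 hy]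
      simp
  · rw [lintegral_indicator_const hmeas, hnull, mul_zero]

/-- Eilenberg's inequality: for boundedly compact metric spaces X, Y, an
L-Lipschitz map f : X → Y, A ⊆ X and 0 ≤ k, h < ∞, the upper integral over Y of
H^k(A ∩ f⁻¹(y)) with respect to H^h is at most C·L^h·H^{k+h}(A), with C = C(k,h). -/
theorem stmt_8 (k h : ℝ) (hk : 0 ≤ k) (hh : 0 ≤ h) :
    ∃ C : ℝ≥0∞, 0 < C ∧ C ≠ ∞ ∧
      ∀ (X Y : Type) [MetricSpace X] [MeasurableSpace X] [BorelSpace X] [ProperSpace X]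
        [MetricSpace Y] [MeasurableSpace Y] [BorelSpace Y] [ProperSpace Y]
        (L : ℝ≥0) (f : X → Y), LipschitzWith L f → ∀ A : Set X,
        upperLintegral (μH[h] : Measure Y) (fun y => μH[k] (A ∩ f ⁻¹' {y})) ≤
          C * (L : ℝ≥0∞) ^ h * μH[k + h] A := by
  classical
  have h45 : (4 * 5 ^ h : ℝ≥0∞) ≠ ∞ :=
    ENNReal.mul_ne_top ofNat_ne_top (rpow_ne_top_of_nonneg hh ofNat_ne_top)
  have h45pos : (0 : ℝ≥0∞) < 4 * 5 ^ h :=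
    ENNReal.mul_pos (by simp) (ENNReal.rpow_pos (by simp) ofNat_ne_top).ne'
  refine ⟨4 * 5 ^ h, h45pos, h45, ?_⟩
  intro X Y _ _ _ _ _ _ _ _ L f hf A
  rcases eq_or_ne ((L : ℝ≥0∞) ^ h) 0 with hLh | hLh
  · obtain ⟨hL, hpos⟩ : (L : ℝ≥0∞) = 0 ∧ 0 < h := by
      simpa [ENNReal.rpow_eq_zero_iff] using hLh
    obtain rfl : L = 0 := by simpa using hL
    rw [upperLintegral_fiber_eq_zero hpos hf]
    exact bot_le
  rcases eq_or_ne (μH[k + h] A) ∞ with hA | hA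
  · rw [hA, ENNReal.mul_top (mul_ne_zero h45pos.ne' hLh)]
    exact le_top
  have hεpos : ∀ n : ℕ, (0 : ℝ≥0∞) < ((n + 1 : ℕ) : ℝ≥0∞)⁻¹ := fun n =>
    ENNReal.inv_pos.2 (ENNReal.natCast_ne_top _)
  have hεtop : ∀ n : ℕ, ((n + 1 : ℕ) : ℝ≥0∞)⁻¹ ≠ ∞ := fun n => by simp
  have hεlim : Tendsto (fun n : ℕ => ((n + 1 : ℕ) : ℝ≥0∞)⁻¹) atTop (𝓝 0) :=
    (tendsto_add_atTop_iff_nat 1).2 ENNReal.tendsto_inv_nat_nhds_zero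
  choose t hAt htε htsum using fun n : ℕ => exists_cover_tsum_le (k + h) hA (hεpos n)
  set F : ℕ → ℕ → Set Y := fun n i => closure (f '' t n i) with hF
  set a : ℕ → ℕ → ℝ≥0 := fun n i => (ediam (t n i) ^ k).toNNReal with ha
  have hcoe : ∀ n i, (a n i : ℝ≥0∞) = ediam (t n i) ^ k := fun n i =>
    ENNReal.coe_toNNReal (rpow_ne_top_of_nonneg hk (ne_top_of_le_ne_top (hεtop n) (htε n i)))
  have hFdiam : ∀ n i, ediam (F n i) ≤ L * ediam (t n i) := fun n i => by
    rw [hF, ediam_closure]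
    exact hf.ediam_image_le _
  have hFr : ∀ n i, ediam (F n i) ≤ L * ((n + 1 : ℕ) : ℝ≥0∞)⁻¹ := fun n i =>
    (hFdiam n i).trans (by gcongr; exact htε n i)
  have hrlim : Tendsto (fun n : ℕ => (L : ℝ≥0∞) * ((n + 1 : ℕ) : ℝ≥0∞)⁻¹) atTop (𝓝 0) := by
    simpa using ENNReal.Tendsto.const_mul hεlim (Or.inr (coe_ne_top (r := L)))
  have hmeas : Measurable fun y => liminf (fun n =>
      ∑' i, (F n i).indicator (fun _ => (a n i : ℝ≥0∞)) y) atTop :=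
    Measurable.liminf fun n => Measurable.tsum fun i =>
      measurable_const.indicator isClosed_closure.measurableSet
  have hfiber : ∀ y, μH[k] (A ∩ f ⁻¹' {y}) ≤ liminf (fun n =>
      ∑' i, (F n i).indicator (fun _ => (a n i : ℝ≥0∞)) y) atTop := fun y => by
    simp_rw [hcoe]
    exact hausdorffMeasure_fiber_le_liminf (fun n i => subset_closure) hAt
      (fun n i => (htε n i).trans (by gcongr; exact n.le_succ)) y
  refine (upperLintegral_le_lintegral hmeas hfiber).trans ((lintegral_liminf_tsum_le hh
    (fun n => ENNReal.mul_ne_top coe_ne_top (hεtop n)) hrlim hFr).trans ?_)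
  have hsum : ∀ n, 4 * 5 ^ h *
      ∑' i, (if (F n i).Nonempty then (a n i : ℝ≥0∞) * ediam (F n i) ^ h else 0) ≤
      4 * 5 ^ h * (L : ℝ≥0∞) ^ h * (μH[k + h] A + ((n + 1 : ℕ) : ℝ≥0∞)⁻¹) := fun n => by
    rw [mul_assoc _ ((L : ℝ≥0∞) ^ h)]
    gcongr
    refine le_trans ?_ (mul_le_mul_right (htsum n) _)
    rw [← ENNReal.tsum_mul_left]
    refine ENNReal.tsum_le_tsum fun i => ?_
    have hne : (F n i).Nonempty ↔ (t n i).Nonempty := by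
      rw [hF, closure_nonempty_iff, image_nonempty]
    simp only [hne]
    split_ifs
    · rw [hcoe, ENNReal.rpow_add_of_nonneg _ _ hk hh, mul_left_comm,
        ← ENNReal.mul_rpow_of_nonneg _ _ hh]
      gcongr
      exact hFdiam n i
    · exact bot_le
  refine (liminf_le_liminf (Eventually.of_forall hsum)).trans_eq ?_
  have hlim := ENNReal.Tendsto.const_mul (a := 4 * 5 ^ h * (L : ℝ≥0∞) ^ h)
    (tendsto_const_nhds.add hεlim : Tendsto (fun n : ℕ => μH[k + h] A + ((n + 1 : ℕ) : ℝ≥0∞)⁻¹)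
      atTop (𝓝 (μH[k + h] A + 0)))
    (Or.inr (ENNReal.mul_ne_top h45 (rpow_ne_top_of_nonneg hh coe_ne_top)))
  rw [hlim.liminf_eq, add_zero]
end

section
/- If X is a proper (boundedly compact) metric space and E ⊆ X is a Borel set, then the s-dimensional Hausdorff content is inner regular by compact sets: H^s_∞(E) = sup{ H^s_∞(K) : K ⊆ E compact }. -/
open MeasureTheory Metric Set ENNReal

/-- The s-dimensional Hausdorff content of a set in an extended metric space. -/
noncomputable def hContent {Z : Type*} [EMetricSpace Z] (s : ℝ) (E : Set Z) : ℝ≥0∞ :=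
  ⨅ (U : ℕ → Set Z) (_ : E ⊆ ⋃ i, U i), ∑' i, EMetric.diam (U i) ^ s

open Filter Topology
open scoped NNReal

/-- The Hausdorff content as an outer measure, for positive exponents. -/
noncomputable def hContentOuter (Z : Type*) [EMetricSpace Z] (s : ℝ) (hs : 0 < s) :
    OuterMeasure Z :=
  OuterMeasure.ofFunction (fun U => ediam U ^ s) (by simp [hs])

lemma hContent_mono {Z : Type*} [EMetricSpace Z] (s : ℝ) {E F : Set Z} (h : E ⊆ F) :
    hContent s E ≤ hContent s F :=
  le_iInf₂ fun U hU => iInf₂_le U (h.trans hU)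

lemma hContent_le_tsum {Z : Type*} [EMetricSpace Z] (s : ℝ) {E : Set Z} {U : ℕ → Set Z}
    (hU : E ⊆ ⋃ i, U i) : hContent s E ≤ ∑' i, ediam (U i) ^ s :=
  iInf₂_le U hU

lemma hContent_zero {Z : Type*} [EMetricSpace Z] (E : Set Z) : hContent 0 E = ∞ := by
  simp [hContent]

lemma hContent_le_hausdorffMeasure {Z : Type*} [EMetricSpace Z] [MeasurableSpace Z]
    [BorelSpace Z] {s : ℝ} (hs : 0 < s) (E : Set Z) : hContent s E ≤ μH[s] E := by
  rw [Measure.hausdorffMeasure_apply]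
  refine le_iSup₂_of_le 1 one_pos (le_iInf fun t => le_iInf fun ht => le_iInf fun _ => ?_)
  refine (hContent_le_tsum s ht).trans (ENNReal.tsum_le_tsum fun i => ?_)
  rcases (t i).eq_empty_or_nonempty with h | h
  · simp [h, hs]
  · simp [h]

/-- A positive sequence with finite sum can be injectively reindexed so as to decay
like the harmonic sequence. -/
lemma exists_injective_mul_le_of_tsum_le {b : ℕ → ℝ≥0∞} (hb : ∀ i, b i ≠ 0) {M : ℝ≥0∞}
    (hM : ∑' i, b i ≤ M) (hM' : M ≠ ∞) :
    ∃ φ : ℕ → ℕ, Function.Injective φ ∧ ∀ i, ((φ i : ℝ≥0∞) + 1) * b i ≤ M := by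
  have hfin : ∀ i, {j | b i < b j ∨ (b j = b i ∧ j < i)}.Finite := fun i =>
    (ENNReal.finite_const_le_of_tsum_ne_top (ne_top_of_le_ne_top hM' hM) (hb i)).subset
      (by rintro j (h | h); exacts [h.le, h.1.ge])
  have hlt : ∀ i j, (b i < b j ∨ (b j = b i ∧ j < i)) →
      (hfin j).toFinset.card < (hfin i).toFinset.card := by
    intro i j hij
    apply Finset.card_lt_card
    rw [Finset.ssubset_iff_of_subset]
    · exact ⟨j, by simpa using hij, by simp⟩
    · intro l hl
      simp only [Finite.mem_toFinset, mem_ofPred_eq] at hl ⊢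
      rcases hl with hl | ⟨hl, hl'⟩ <;> rcases hij with hij | ⟨hij, hij'⟩
      · exact Or.inl (hij.trans hl)
      · exact Or.inl (hij ▸ hl)
      · exact Or.inl (hl ▸ hij)
      · exact Or.inr ⟨hl.trans hij, hl'.trans hij'⟩
  refine ⟨fun i => (hfin i).toFinset.card, fun i j hij => ?_, fun i => ?_⟩
  · by_contra hne
    have : (b i < b j ∨ (b j = b i ∧ j < i)) ∨ (b j < b i ∨ (b i = b j ∧ i < j)) := by
      rcases lt_trichotomy (b i) (b j) with h | h | h
      · exact Or.inl (Or.inl h)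
      · rcases lt_or_gt_of_ne hne with h' | h'
        · exact Or.inr (Or.inr ⟨h, h'⟩)
        · exact Or.inl (Or.inr ⟨h.symm, h'⟩)
      · exact Or.inr (Or.inl h)
    rcases this with h | h
    · exact (hlt _ _ h).ne hij.symm
    · exact (hlt _ _ h).ne hij
  · have hi : i ∉ (hfin i).toFinset := by simp
    calc (((hfin i).toFinset.card : ℝ≥0∞) + 1) * b i
        = (insert i (hfin i).toFinset).card • b i := by
          rw [Finset.card_insert_of_notMem hi, nsmul_eq_mul]; push_cast; rfl
      _ ≤ ∑ j ∈ insert i (hfin i).toFinset, b j := by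
          refine Finset.card_nsmul_le_sum _ _ _ fun j hj => ?_
          simp only [Finset.mem_insert, Finite.mem_toFinset, mem_ofPred_eq] at hj
          rcases hj with rfl | hj | hj
          exacts [le_rfl, hj.le, hj.1.ge]
      _ ≤ M := (ENNReal.sum_le_tsum _).trans hM

lemma exists_cover_of_hContent_lt {Z : Type*} [EMetricSpace Z] {s : ℝ} {E : Set Z}
    {M : ℝ≥0∞} (h : hContent s E < M) :
    ∃ U : ℕ → Set Z, E ⊆ ⋃ i, U i ∧ ∑' i, ediam (U i) ^ s < M := by
  simp only [hContent, iInf_lt_iff] at h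
  obtain ⟨U, hU, h⟩ := h
  exact ⟨U, hU, h⟩

/-- Near-optimal covers may be ordered so that the diameters decay at a uniform rate. -/
lemma exists_cover_decay_of_hContent_lt {Z : Type*} [EMetricSpace Z] {s : ℝ} (hs : 0 < s)
    {E : Set Z} {M : ℝ≥0∞} (hM : M ≠ ∞) (h : hContent s E < M) :
    ∃ U : ℕ → Set Z, E ⊆ ⋃ i, U i ∧ ∑' i, ediam (U i) ^ s ≤ M ∧
      ∀ i : ℕ, ((i : ℝ≥0∞) + 1) * ediam (U i) ^ s ≤ M := by
  obtain ⟨U, hU, hUM⟩ := exists_cover_of_hContent_lt h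
  obtain ⟨c, hc, hcs⟩ := ENNReal.exists_pos_sum_of_countable' (tsub_pos_of_lt hUM).ne' ℕ
  have hsum : ∑' i, (ediam (U i) ^ s + c i) ≤ M := by
    rw [ENNReal.tsum_add]
    calc _ ≤ ∑' i, ediam (U i) ^ s + (M - ∑' i, ediam (U i) ^ s) := by gcongr
      _ = M := add_tsub_cancel_of_le hUM.le
  obtain ⟨φ, hφ, hφM⟩ := exists_injective_mul_le_of_tsum_le
    (fun i => ((hc i).trans_le le_add_self).ne') hsum hM
  set V : ℕ → Set Z := Function.extend φ U fun _ => ∅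
  have hV : ∀ i, V (φ i) = U i := fun i => hφ.extend_apply _ _ _
  have hV' : ∀ k, k ∉ range φ → V k = ∅ := fun k hk => by
    simp only [V]; rw [Function.extend_apply' _ _ _ (by simpa using hk)]
  refine ⟨V, fun x hx => ?_, ?_, fun k => ?_⟩
  · obtain ⟨i, hi⟩ := mem_iUnion.1 (hU hx)
    exact mem_iUnion.2 ⟨φ i, by rwa [hV]⟩
  · rw [← hφ.tsum_eq (f := fun k => ediam (V k) ^ s)]
    · simpa only [hV] using hUM.le
    · intro k hk
      by_contra hk'
      simp [hV' k hk', hs] at hk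
  · by_cases hk : k ∈ range φ
    · obtain ⟨i, rfl⟩ := hk
      rw [hV]
      refine le_trans ?_ (hφM i)
      gcongr
      exact le_self_add
    · simp [hV' k hk, hs]

/-- A set of finite diameter has open thickenings of nearly the same `s`-th power of diameter. -/
lemma exists_thickening_ediam_rpow_le {X : Type*} [MetricSpace X] {s : ℝ} (hs : 0 < s)
    {A : Set X} {D : ℝ≥0∞} (hA : ediam A ≤ D) (hD : D ≠ ∞) {ε : ℝ≥0∞} (hε : ε ≠ 0) :
    ∃ ρ : ℝ, 0 < ρ ∧ ediam (thickening ρ A) ^ s ≤ D ^ s + ε := by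
  have hcont : Tendsto (fun r : ℝ≥0 => (D + 2 * (r : ℝ≥0∞)) ^ s) (𝓝[>] 0) (𝓝 (D ^ s)) := by
    have h1 : Continuous fun r : ℝ≥0 => D + 2 * (r : ℝ≥0∞) :=
      continuous_const.add (ENNReal.continuous_const_mul (by finiteness) |>.comp ENNReal.continuous_coe)
    have := ((ENNReal.continuous_rpow_const (y := s)).comp h1).tendsto 0
    simp only [Function.comp_def, ENNReal.coe_zero, mul_zero, add_zero] at this
    exact this.mono_left nhdsWithin_le_nhds
  have hlt : D ^ s < D ^ s + ε :=
    ENNReal.lt_add_right (ENNReal.rpow_ne_top_of_nonneg hs.le hD) hε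
  obtain ⟨r, hr, hr0⟩ := ((hcont.eventually_lt_const hlt).and self_mem_nhdsWithin).exists
  refine ⟨r, hr0, le_trans ?_ hr.le⟩
  gcongr
  exact (ediam_thickening_le r).trans (by gcongr)

/-- The limit of a sequence of sets along an ultrafilter. -/
def ultraLimit {X : Type*} [MetricSpace X] (𝒰 : Ultrafilter ℕ) (U : ℕ → Set X) : Set X :=
  {x | ∀ r > 0, ∀ᶠ m in (𝒰 : Filter ℕ), (ball x r ∩ U m).Nonempty}

lemma ediam_ultraLimit_le {X : Type*} [MetricSpace X] {𝒰 : Ultrafilter ℕ} {U : ℕ → Set X}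
    {D : ℝ≥0∞} (hD : Tendsto (fun m => ediam (U m)) 𝒰 (𝓝 D)) :
    ediam (ultraLimit 𝒰 U) ≤ D := by
  refine ediam_le fun x hx y hy => ?_
  refine ENNReal.le_of_forall_pos_le_add fun ε hε _ => ?_
  have hε2 : (0 : ℝ) < (ε / 2 : ℝ≥0) := by positivity
  refine ge_of_tendsto (hD.add_const (ε : ℝ≥0∞)) ?_
  filter_upwards [hx _ hε2, hy _ hε2] with m ⟨x', hx', hx'U⟩ ⟨y', hy', hy'U⟩
  have h1 : edist x x' ≤ (ε / 2 : ℝ≥0) := by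
    rw [edist_comm, edist_nndist]
    exact_mod_cast (mem_ball.1 hx').le
  have h2 : edist y' y ≤ (ε / 2 : ℝ≥0) := by
    rw [edist_nndist]
    exact_mod_cast (mem_ball.1 hy').le
  calc edist x y ≤ edist x x' + edist x' y' + edist y' y := edist_triangle4 _ _ _ _
    _ ≤ (ε / 2 : ℝ≥0) + ediam (U m) + (ε / 2 : ℝ≥0) := by
      gcongr; exact edist_le_ediam_of_mem hx'U hy'U
    _ = ediam (U m) + ((ε / 2 : ℝ≥0) + (ε / 2 : ℝ≥0) : ℝ≥0) := by push_cast; ring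
    _ = _ := by rw [add_halves]

lemma eventually_inter_subset_thickening_ultraLimit {X : Type*} [MetricSpace X]
    (𝒰 : Ultrafilter ℕ) (U : ℕ → Set X) {B : Set X} (hB : IsCompact B) {ρ : ℝ} (hρ : 0 < ρ) :
    ∀ᶠ m in (𝒰 : Filter ℕ), U m ∩ B ⊆ thickening ρ (ultraLimit 𝒰 U) := by
  by_contra hcon
  rw [← Ultrafilter.eventually_not] at hcon
  have hne : ∃ x0 : X, True := by
    obtain ⟨m, hm⟩ := hcon.exists
    obtain ⟨x, -, -⟩ := not_subset.1 hm
    exact ⟨x, trivial⟩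
  have : ∀ m, ∃ x : X, (¬ U m ∩ B ⊆ thickening ρ (ultraLimit 𝒰 U)) →
      x ∈ U m ∩ B ∧ x ∉ thickening ρ (ultraLimit 𝒰 U) := by
    intro m
    by_cases h : U m ∩ B ⊆ thickening ρ (ultraLimit 𝒰 U)
    · exact ⟨hne.choose, fun h' => (h' h).elim⟩
    · obtain ⟨x, h1, h2⟩ := not_subset.1 h
      exact ⟨x, fun _ => ⟨h1, h2⟩⟩
  choose x hx using this
  have hx : ∀ᶠ m in (𝒰 : Filter ℕ), x m ∈ U m ∩ B ∧ x m ∉ thickening ρ (ultraLimit 𝒰 U) :=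
    hcon.mono hx
  obtain ⟨a, -, ha⟩ := hB.ultrafilter_le_nhds (𝒰.map x)
    (le_principal_iff.2 (hx.mono fun m hm => hm.1.2))
  have ha : Tendsto x 𝒰 (𝓝 a) := ha
  have haU : a ∈ ultraLimit 𝒰 U := fun r hr => by
    filter_upwards [hx, ha (ball_mem_nhds a hr)] with m hm hm'
    exact ⟨x m, hm', hm.1.1⟩
  obtain ⟨m, hm, hm'⟩ := (hx.and (ha (ball_mem_nhds a hρ))).exists
  exact hm.2 (mem_thickening_iff.2 ⟨a, haU, hm'⟩)

/-- The Hausdorff content is continuous along increasing sequences of sets. -/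
lemma hContent_iUnion_le {X : Type*} [MetricSpace X] [ProperSpace X]
    [MeasurableSpace X] [BorelSpace X] {s : ℝ} (hs : 0 < s) {E : ℕ → Set X} (hE : Monotone E) :
    hContent s (⋃ n, E n) ≤ ⨆ n, hContent s (E n) := by
  rcases isEmpty_or_nonempty X with hX | ⟨⟨o⟩⟩
  · rw [eq_empty_of_isEmpty (⋃ n, E n), eq_empty_of_isEmpty (E 0) |>.symm]
    exact le_iSup (fun n => hContent s (E n)) 0
  refine ENNReal.le_of_forall_pos_le_add fun ε hε hL => ?_
  set L := ⨆ n, hContent s (E n)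
  have hε2 : ((ε / 2 : ℝ≥0) : ℝ≥0∞) ≠ 0 := by simpa using hε.ne'
  set M : ℝ≥0∞ := L + (ε / 2 : ℝ≥0)
  have hM : M ≠ ∞ := ENNReal.add_ne_top.2 ⟨hL.ne, ENNReal.coe_ne_top⟩
  have hEM : ∀ n, hContent s (E n) < M := fun n =>
    (le_iSup (fun n => hContent s (E n)) n).trans_lt (ENNReal.lt_add_right hL.ne hε2)
  choose U hU hUM hUdecay using fun n => exists_cover_decay_of_hContent_lt hs hM (hEM n)
  let 𝒰 : Ultrafilter ℕ := hyperfilter ℕ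
  have hlim : ∀ f : ℕ → ℝ≥0∞, ∃ a, Tendsto f 𝒰 (𝓝 a) := fun f =>
    let ⟨a, _, ha⟩ := isCompact_univ.ultrafilter_le_nhds (𝒰.map f) (by simp)
    ⟨a, ha⟩
  choose D hD using fun i => hlim fun m => ediam (U m i)
  have hDs : ∀ i, Tendsto (fun m => ediam (U m i) ^ s) 𝒰 (𝓝 (D i ^ s)) := fun i =>
    ((ENNReal.continuous_rpow_const (y := s)).tendsto _).comp (hD i)
  have hDM : ∀ i, D i ^ s ≤ M := fun i =>
    le_of_tendsto (hDs i) (.of_forall fun m =>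
      (ENNReal.le_tsum (f := fun i => ediam (U m i) ^ s) i).trans (hUM m))
  have hDtop : ∀ i, D i ≠ ∞ := fun i h => by
    have := hDM i
    rw [h, ENNReal.top_rpow_of_pos hs] at this
    exact hM (top_le_iff.1 this)
  obtain ⟨c, hc, hcs⟩ := ENNReal.exists_pos_sum_of_countable' hε2 ℕ
  choose ρ hρ hρD using fun i => exists_thickening_ediam_rpow_le hs
    (ediam_ultraLimit_le (hD i)) (hDtop i) (hc i).ne'
  set V : ℕ → Set X := fun i => thickening (ρ i) (ultraLimit 𝒰 fun m => U m i)
  set A : ℕ → Set X := fun n => (E n ∩ closedBall o n) \ ⋃ i, V i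
  have hA : Monotone A := fun m n h =>
    sdiff_subset_sdiff_left (inter_subset_inter (hE h) (closedBall_subset_closedBall (by simpa)))
  choose τ hτ using fun k => hlim fun m => ∑' i, ediam (U m (i + k)) ^ s
  have hcover : ∀ n k, ∀ᶠ m in (𝒰 : Filter ℕ), A n ⊆ ⋃ i, U m (i + k) := by
    intro n k
    have h1 : ∀ᶠ m in (𝒰 : Filter ℕ), ∀ i ∈ Finset.range k, U m i ∩ closedBall o n ⊆ V i :=
      (Finset.eventually_all _).2 fun i _ =>
        eventually_inter_subset_thickening_ultraLimit 𝒰 _ (isCompact_closedBall o n) (hρ i)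
    have h2 : ∀ᶠ m in (𝒰 : Filter ℕ), n ≤ m :=
      (eventually_ge_atTop n).filter_mono Nat.hyperfilter_le_atTop
    filter_upwards [h1, h2] with m h1 h2 x hx
    obtain ⟨i, hi⟩ := mem_iUnion.1 (hU m (hE h2 hx.1.1))
    have hik : k ≤ i := by
      by_contra! hik
      exact hx.2 (mem_iUnion.2 ⟨i, h1 i (Finset.mem_range.2 hik) ⟨hi, hx.1.2⟩⟩)
    exact mem_iUnion.2 ⟨i - k, by rwa [Nat.sub_add_cancel hik]⟩
  have hAτ : ∀ n k, μH[s] (A n) ≤ τ k := by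
    intro n k
    rw [Measure.hausdorffMeasure_apply]
    refine iSup₂_le fun r hr => ?_
    obtain ⟨l, hkl, hl⟩ : ∃ l, k ≤ l ∧ M ≤ ((l : ℝ≥0∞) + 1) * r ^ s := by
      rcases eq_or_ne r ∞ with rfl | hr'
      · exact ⟨k, le_rfl, by simp [ENNReal.top_rpow_of_pos hs]⟩
      · have hr0 : r ^ s ≠ 0 := by simp [hr.ne', hs.le]
        obtain ⟨l, hl⟩ := ENNReal.exists_nat_mul_gt hr0 hM
        refine ⟨max k l, le_max_left _ _, hl.le.trans ?_⟩
        gcongr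
        exact le_add_right (by exact_mod_cast le_max_right k l)
    refine ge_of_tendsto (hτ k) ?_
    filter_upwards [hcover n l] with m hm
    have hdiam : ∀ i, ediam (U m (i + l)) ≤ r := by
      intro i
      rw [← ENNReal.rpow_le_rpow_iff hs]
      have h1 : ((l : ℝ≥0∞) + 1) * ediam (U m (i + l)) ^ s ≤ ((l : ℝ≥0∞) + 1) * r ^ s := by
        refine le_trans ?_ ((hUdecay m (i + l)).trans hl)
        gcongr
        exact_mod_cast Nat.le_add_left l i
      exact (ENNReal.mul_le_mul_iff_right (by simp) (by simp)).1 h1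
    refine (iInf₂_le_of_le (fun i => U m (i + l)) hm (iInf_le _ hdiam)).trans ?_
    calc _ ≤ ∑' i, ediam (U m (i + l)) ^ s :=
          ENNReal.tsum_le_tsum fun i => iSup_le fun _ => le_rfl
      _ = ∑' i, ediam (U m (i + (l - k) + k)) ^ s := by
          simp only [add_assoc, Nat.sub_add_cancel hkl]
      _ ≤ ∑' i, ediam (U m (i + k)) ^ s :=
          ENNReal.tsum_comp_le_tsum_of_injective (add_left_injective (l - k))
            (fun i => ediam (U m (i + k)) ^ s)
  have hμA : μH[s] (⋃ n, A n) = ⨆ n, μH[s] (A n) := hA.measure_iUnion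
  have hsum : ∑' i, D i ^ s + μH[s] (⋃ n, A n) ≤ M := by
    rw [ENNReal.tsum_eq_iSup_nat, ENNReal.iSup_add]
    refine iSup_le fun k => ?_
    calc _ ≤ ∑ i ∈ Finset.range k, D i ^ s + τ k := by
          gcongr; rw [hμA]; exact iSup_le fun n => hAτ n k
      _ ≤ M := by
          refine le_of_tendsto ((tendsto_finsetSum _ fun i _ => hDs i).add (hτ k))
            (.of_forall fun m => ?_)
          rw [Summable.sum_add_tsum_nat_add' ENNReal.summable]
          exact hUM m
  have hsub : (⋃ n, E n) ⊆ (⋃ i, V i) ∪ ⋃ n, A n := by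
    intro x hx
    by_cases hxV : x ∈ ⋃ i, V i
    · exact Or.inl hxV
    obtain ⟨n, hn⟩ := mem_iUnion.1 hx
    obtain ⟨k, hk⟩ := exists_nat_ge (dist x o)
    refine Or.inr (mem_iUnion.2 ⟨max n k, ⟨hE (le_max_left _ _) hn, ?_⟩, hxV⟩)
    exact mem_closedBall.2 (hk.trans (by exact_mod_cast le_max_right n k))
  calc hContent s (⋃ n, E n) ≤ hContent s ((⋃ i, V i) ∪ ⋃ n, A n) := hContent_mono s hsub
    _ ≤ hContent s (⋃ i, V i) + hContent s (⋃ n, A n) :=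
        measure_union_le (μ := hContentOuter X s hs) _ _
    _ ≤ ∑' i, (D i ^ s + c i) + μH[s] (⋃ n, A n) := by
        gcongr
        · exact (hContent_le_tsum s Subset.rfl).trans (ENNReal.tsum_le_tsum hρD)
        · exact hContent_le_hausdorffMeasure hs _
    _ = ∑' i, D i ^ s + μH[s] (⋃ n, A n) + ∑' i, c i := by
        rw [ENNReal.tsum_add]; ring
    _ ≤ M + (ε / 2 : ℝ≥0) := by gcongr
    _ = L + ε := by
        simp only [M]; rw [add_assoc, ← ENNReal.coe_add, add_halves]

/-- An open neighbourhood of a compact box in the Baire space contains the set of sequences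
satisfying the bounds of the box on finitely many coordinates. -/
lemma exists_forall_lt_le_subset_of_isOpen {N : ℕ → ℕ} {O : Set (ℕ → ℕ)} (hO : IsOpen O)
    (hN : {x : ℕ → ℕ | ∀ i, x i ≤ N i} ⊆ O) :
    ∃ k, {x : ℕ → ℕ | ∀ i < k, x i ≤ N i} ⊆ O := by
  by_contra! hcon
  choose x hx hxO using fun k => not_subset.1 (hcon k)
  have hcpt : IsCompact (univ.pi fun i => Iic (N i)) :=
    isCompact_univ_pi fun i => (finite_Iic (N i)).isCompact
  let y : ℕ → ℕ → ℕ := fun k i => min (x k i) (N i)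
  let 𝒰 : Ultrafilter ℕ := hyperfilter ℕ
  obtain ⟨a, ha, hya⟩ := hcpt.ultrafilter_le_nhds (𝒰.map y)
    (le_principal_iff.2 (show ∀ᶠ k in (𝒰 : Filter ℕ), y k ∈ univ.pi fun i => Iic (N i) from
      .of_forall fun k i _ => min_le_right (x k i) (N i)))
  have hya : Tendsto y 𝒰 (𝓝 a) := hya
  have hxa : Tendsto x 𝒰 (𝓝 a) := by
    rw [tendsto_pi_nhds] at hya ⊢
    intro i
    refine (hya i).congr' ?_
    filter_upwards [(eventually_gt_atTop i).filter_mono Nat.hyperfilter_le_atTop] with k hk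
    exact min_eq_left (hx k i hk)
  obtain ⟨k, hk⟩ := (hxa.eventually (hO.mem_nhds (hN fun i => ha i trivial))).exists
  exact hxO k hk

/-- Capacitability of continuous images of the Baire space for the Hausdorff content. -/
lemma exists_isCompact_subset_range_le_hContent {X : Type*} [MetricSpace X] [ProperSpace X]
    [MeasurableSpace X] [BorelSpace X] {s : ℝ} (hs : 0 < s) {f : (ℕ → ℕ) → X}
    (hf : Continuous f) {L : ℝ≥0∞} (hL : L < hContent s (range f)) :
    ∃ K, IsCompact K ∧ K ⊆ range f ∧ L ≤ hContent s K := by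
  have hstep : ∀ C : Set (ℕ → ℕ), ∀ k, L < hContent s (f '' C) →
      ∃ n, L < hContent s (f '' (C ∩ {x | x k ≤ n})) := by
    intro C k hC
    have hU : f '' C = ⋃ n, f '' (C ∩ {x | x k ≤ n}) := by
      rw [← image_iUnion, ← inter_iUnion]
      congr 1
      refine (inter_eq_left.2 fun x _ => ?_).symm
      exact mem_iUnion.2 ⟨x k, le_refl (x k)⟩
    rw [hU] at hC
    have := hC.trans_le (hContent_iUnion_le hs fun m n hmn =>
      image_mono (inter_subset_inter_right C fun x (hx : x k ≤ m) => hx.trans hmn))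
    exact lt_iSup_iff.1 this
  choose! g hg using hstep
  let C : ℕ → Set (ℕ → ℕ) := Nat.rec univ fun k C => C ∩ {x | x k ≤ g C k}
  have hCL : ∀ k, L < hContent s (f '' C k) := by
    intro k
    induction k with
    | zero => simpa [C] using hL
    | succ k ih => exact hg _ _ ih
  let N : ℕ → ℕ := fun k => g (C k) k
  have hCN : ∀ k, C k = {x | ∀ i < k, x i ≤ N i} := by
    intro k
    induction k with
    | zero => simp [C]
    | succ k ih =>
      have : C (k + 1) = C k ∩ {x | x k ≤ N k} := rfl
      rw [this, ih]
      ext x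
      simp only [mem_inter_iff, mem_ofPred_eq, Nat.lt_succ_iff_lt_or_eq, or_imp, forall_and,
        forall_eq]
  have hK : IsCompact {x : ℕ → ℕ | ∀ i, x i ≤ N i} := by
    have : {x : ℕ → ℕ | ∀ i, x i ≤ N i} = univ.pi fun i => Iic (N i) := by
      ext; simp only [mem_ofPred_eq, mem_univ_pi, mem_Iic]
    rw [this]
    exact isCompact_univ_pi fun i => (finite_Iic (N i)).isCompact
  refine ⟨_, hK.image hf, image_subset_range _ _, ?_⟩
  by_contra! hlt
  obtain ⟨U, hU, hUL⟩ := exists_cover_of_hContent_lt hlt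
  obtain ⟨c, hc, hcs⟩ := ENNReal.exists_pos_sum_of_countable' (tsub_pos_of_lt hUL).ne' ℕ
  have hfin : ∀ i, ediam (U i) ≠ ∞ := fun i h => by
    have := (ENNReal.le_tsum (f := fun i => ediam (U i) ^ s) i).trans_lt hUL
    simp [h, ENNReal.top_rpow_of_pos hs] at this
  choose ρ hρ hρU using fun i => exists_thickening_ediam_rpow_le hs le_rfl (hfin i) (hc i).ne'
  have hO : IsOpen (⋃ i, thickening (ρ i) (U i)) := isOpen_iUnion fun i => isOpen_thickening
  obtain ⟨k, hk⟩ := exists_forall_lt_le_subset_of_isOpen (hO.preimage hf)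
    (image_subset_iff.1 (hU.trans (iUnion_mono fun i => self_subset_thickening (hρ i) _)))
  rw [← hCN, ← image_subset_iff] at hk
  refine (hCL k).not_ge ?_
  calc hContent s (f '' C k) ≤ ∑' i, (ediam (U i) ^ s + c i) :=
        (hContent_le_tsum s hk).trans (ENNReal.tsum_le_tsum hρU)
    _ ≤ ∑' i, ediam (U i) ^ s + (L - ∑' i, ediam (U i) ^ s) := by
        rw [ENNReal.tsum_add]; gcongr
    _ = L := add_tsub_cancel_of_le hUL.le

/-- in a proper metric space, the s-dimensional Hausdorff content is inner
regular by compact sets on Borel sets: H^s_∞(E) = sup{H^s_∞(K) : K ⊆ E compact}. -/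
theorem stmt_11 {X : Type*} [MetricSpace X] [ProperSpace X]
    [MeasurableSpace X] [BorelSpace X]
    (s : ℝ) (hs : 0 ≤ s) (E : Set X) (hE : MeasurableSet E) :
    hContent s E = ⨆ (K : Set X) (_ : IsCompact K) (_ : K ⊆ E), hContent s K := by
  refine le_antisymm ?_ (iSup_le fun K => iSup₂_le fun _ hKE => hContent_mono s hKE)
  have hempty : hContent s (∅ : Set X) ≤
      ⨆ (K : Set X) (_ : IsCompact K) (_ : K ⊆ E), hContent s K :=
    le_iSup_of_le ∅ (le_iSup₂_of_le isCompact_empty (empty_subset E) le_rfl)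
  rcases hs.eq_or_lt with rfl | hs
  · simpa only [hContent_zero] using hempty
  have hEa := hE.analyticSet
  rw [AnalyticSet] at hEa
  rcases hEa with rfl | ⟨f, hf, rfl⟩
  · exact hempty
  refine le_of_forall_lt fun L hL => ?_
  obtain ⟨L', hLL', hL'⟩ := exists_between hL
  obtain ⟨K, hK, hKE, hLK⟩ := exists_isCompact_subset_range_le_hContent hs hf hL'
  exact hLL'.trans_le (hLK.trans (le_iSup_of_le K (le_iSup₂_of_le hK hKE le_rfl)))
end

section
/- Let X be a complete metric space with doubling measure μ supporting a weak (1,p)-Poincaré inequality for some p > Q = log₂ C_μ, and satisfying the lower mass bound c r^Q ≤ μ(B(x,r)). Then every u ∈ N^{1,p}_loc(X; V) (V a Banach space) satisfies the weak Q-Radó–Reichelderfer condition: there exist constants C, α ≥ 1 such that diam(u(B(x,r)))^Q ≤ C ∫_{B(x,αr)} (1 + g_u^p) dμ for all sufficiently small balls, where g_u is a minimal p-weak upper gradient of u. Consequently u is locally Q-absolutely continuous. -/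
open MeasureTheory Metric Set ENNReal NNReal

/-- A curve in X: a 1-Lipschitz (arclength) parametrization on [0, len]. -/
structure MCurve (X : Type*) [MetricSpace X] where
  len : ℝ
  len_nonneg : 0 ≤ len
  toFun : ℝ → X
  lip : LipschitzOnWith 1 toFun (Set.Icc 0 len)

/-- The curve integral ∫_γ g ds, via the arclength parametrization. -/
noncomputable def curveLint {X : Type*} [MetricSpace X] [MeasurableSpace X]
    (γ : MCurve X) (g : X → ℝ≥0∞) : ℝ≥0∞ :=
  ∫⁻ t in Set.Icc (0 : ℝ) γ.len, g (γ.toFun t)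

/-- g is an upper gradient of f if the upper gradient inequality holds on every curve. -/
def IsUpperGradient {X Y : Type*} [MetricSpace X] [MeasurableSpace X] [PseudoEMetricSpace Y]
    (f : X → Y) (g : X → ℝ≥0∞) : Prop :=
  ∀ γ : MCurve X, edist (f (γ.toFun γ.len)) (f (γ.toFun 0)) ≤ curveLint γ g

/-- The p-modulus of a family of curves. -/
noncomputable def pModulus {X : Type*} [MetricSpace X] [MeasurableSpace X]
    (μ : Measure X) (p : ℝ) (Γ : Set (MCurve X)) : ℝ≥0∞ :=
  ⨅ (ρ : X → ℝ≥0∞) (_ : Measurable ρ) (_ : ∀ γ ∈ Γ, 1 ≤ curveLint γ ρ),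
    ∫⁻ x, ρ x ^ p ∂μ

/-- g is a p-weak upper gradient of f: the upper gradient inequality holds for all curves
outside a family of p-modulus zero. -/
def IsWeakUpperGradient {X Y : Type*} [MetricSpace X] [MeasurableSpace X]
    [PseudoEMetricSpace Y] (μ : Measure X) (p : ℝ) (f : X → Y) (g : X → ℝ≥0∞) : Prop :=
  ∃ Γ : Set (MCurve X), pModulus μ p Γ = 0 ∧
    ∀ γ : MCurve X, γ ∉ Γ → edist (f (γ.toFun γ.len)) (f (γ.toFun 0)) ≤ curveLint γ g

/-- g is a minimal p-weak upper gradient of f. -/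
def IsMinimalWeakUpperGradient {X Y : Type*} [MetricSpace X] [MeasurableSpace X]
    [PseudoEMetricSpace Y] (μ : Measure X) (p : ℝ) (f : X → Y) (g : X → ℝ≥0∞) : Prop :=
  IsWeakUpperGradient μ p f g ∧ (∫⁻ x, g x ^ p ∂μ) ≠ ∞ ∧
    ∀ h : X → ℝ≥0∞, Measurable h → IsWeakUpperGradient μ p f h →
      (∫⁻ x, h x ^ p ∂μ) ≠ ∞ → ∀ᵐ x ∂μ, g x ≤ h x

/-- X supports a weak (1,p)-Poincaré inequality with constants CP and dilation τ. -/
def WeakPoincare {X : Type*} [MetricSpace X] [MeasurableSpace X]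
    (μ : Measure X) (p CP τ : ℝ) : Prop :=
  ∀ (f : X → ℝ) (g : X → ℝ≥0∞), Measurable g → IsWeakUpperGradient μ p f g →
    ∀ (x : X) (r : ℝ), 0 < r →
      (∫⁻ y in ball x r, ENNReal.ofReal |f y - ⨍ z in ball x r, f z ∂μ| ∂μ) /
          μ (ball x r) ≤
        ENNReal.ofReal (CP * r) *
          ((∫⁻ y in ball x (τ * r), g y ^ p ∂μ) / μ (ball x (τ * r))) ^ (1 / p)

open Filter Topology

/-- A complete metric space carrying a measure that is finite on balls and bounded below on balls
of each fixed radius is proper. -/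
theorem properSpace_of_measure_ball_ge {X : Type*} [MetricSpace X] [CompleteSpace X]
    [MeasurableSpace X] [BorelSpace X] (μ : Measure X)
    (hfin : ∀ (x : X) (r : ℝ), 0 < r → μ (ball x r) < ∞)
    (hlow : ∀ r : ℝ, 0 < r → ∃ m : ℝ≥0∞, 0 < m ∧ ∀ x : X, m ≤ μ (ball x r)) :
    ProperSpace X := by
  refine ⟨fun x r => TotallyBounded.isCompact_of_isClosed ?_ isClosed_closedBall⟩
  rw [Metric.totallyBounded_iff]
  intro ε hε
  obtain ⟨m, hm, hlow⟩ := hlow (ε / 6) (by positivity)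
  obtain ⟨v, hv, hdisj, hcov⟩ :=
    Vitali.exists_disjoint_subfamily_covering_enlargement_closedBall (closedBall x r)
      (fun y => y) (fun _ => ε / 6) (ε / 6) (fun _ _ => le_rfl) 5 (by norm_num)
  refine ⟨v, ?_, fun y hy => ?_⟩
  · have hunion : μ (⋃ i : v, closedBall (i : X) (ε / 6)) ≠ ∞ := by
      refine ne_top_of_le_ne_top (hfin x (|r| + ε) (by positivity)).ne (measure_mono ?_)
      refine iUnion_subset fun i z hz => ?_
      have h1 := mem_closedBall.1 (hv i.2)
      have h2 := mem_closedBall.1 hz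
      have h3 := dist_triangle z i x
      have h4 := le_abs_self r
      rw [mem_ball]
      linarith
    have hfinite := Measure.finite_const_le_meas_of_disjoint_iUnion μ hm
      (fun i : v => (isClosed_closedBall (x := (i : X)) (ε := ε / 6)).measurableSet)
      (fun i j hij => hdisj i.2 j.2 (fun h => hij (Subtype.ext h))) hunion
    have huniv : {i : v | m ≤ μ (closedBall (i : X) (ε / 6))} = univ :=
      eq_univ_of_forall fun i => (hlow i).trans (measure_mono ball_subset_closedBall)
    rw [huniv] at hfinite
    exact Set.finite_coe_iff.1 (Set.finite_univ_iff.1 hfinite)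
  · obtain ⟨b, hb, hsub⟩ := hcov y hy
    have := mem_closedBall.1 (hsub (mem_closedBall_self (by positivity)))
    exact mem_biUnion hb (mem_ball.2 (by linarith))

/-- The parametrization of a curve extends to a `1`-Lipschitz map on the whole line. -/
theorem MCurve.exists_lipschitzWith_eqOn {X : Type*} [MetricSpace X] (γ : MCurve X) :
    ∃ f : ℝ → X, LipschitzWith 1 f ∧ EqOn f γ.toFun (Icc 0 γ.len) := by
  refine ⟨fun t => γ.toFun (projIcc 0 γ.len γ.len_nonneg t), ?_, fun t ht => ?_⟩
  · simpa [Function.comp_def] using γ.lip.to_restrict.comp (LipschitzWith.projIcc γ.len_nonneg)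
  · simp [projIcc_of_mem γ.len_nonneg ht]

/-- The curve traced by a `1`-Lipschitz map on `[0, L]`. -/
def MCurve.ofLipschitzWith {X : Type*} [MetricSpace X] (f : ℝ → X) (hf : LipschitzWith 1 f)
    (L : ℝ) (hL : 0 ≤ L) : MCurve X :=
  ⟨L, hL, f, hf.lipschitzOnWith⟩

theorem curveLint_eq_of_eqOn {X : Type*} [MetricSpace X] [MeasurableSpace X] {γ : MCurve X}
    {f : ℝ → X} (h : EqOn f γ.toFun (Icc 0 γ.len)) (G : X → ℝ≥0∞) :
    curveLint γ G = ∫⁻ t in Icc (0 : ℝ) γ.len, G (f t) :=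
  setLIntegral_congr_fun measurableSet_Icc fun t ht => by simp only [h ht]

/-- **Arzelà–Ascoli** for `1`-Lipschitz maps from the line to a proper space. -/
theorem exists_subseq_tendsto_of_lipschitzWith {X : Type*} [MetricSpace X] [ProperSpace X]
    (f : ℕ → ℝ → X) (hf : ∀ n, LipschitzWith 1 (f n)) {x : X}
    (hx : Tendsto (fun n => f n 0) atTop (𝓝 x)) {M : ℝ} (hM : 0 ≤ M) :
    ∃ F : ℝ → X, LipschitzWith 1 F ∧ ∃ φ : ℕ → ℕ, StrictMono φ ∧
      ∀ t ∈ Icc 0 M, Tendsto (fun n => f (φ n) t) atTop (𝓝 (F t)) := by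
  obtain ⟨B, hB⟩ := (Metric.isBounded_range_of_tendsto _ hx).subset_closedBall x
  let A : Set (BoundedContinuousFunction (Icc (0 : ℝ) M) X) :=
    {h | LipschitzWith 1 h ∧ ∀ t, h t ∈ closedBall x (B + M)}
  have hclosed : IsClosed A := by
    have h1 : A = (⋂ (s : Icc (0 : ℝ) M) (t : Icc (0 : ℝ) M),
        {h : BoundedContinuousFunction (Icc (0 : ℝ) M) X | dist (h s) (h t) ≤ dist s t}) ∩
        ⋂ t : Icc (0 : ℝ) M, {h | dist (h t) x ≤ B + M} := by
      ext h
      simp only [A, lipschitzWith_iff_dist_le_mul, NNReal.coe_one, one_mul, mem_closedBall,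
        mem_ofPred_eq, mem_inter_iff, mem_iInter]
    rw [h1]
    have hev : ∀ t : Icc (0 : ℝ) M,
        Continuous fun h : BoundedContinuousFunction (Icc (0 : ℝ) M) X => h t :=
      fun t => (BoundedContinuousFunction.lipschitz_eval_const t).continuous
    refine IsClosed.inter (isClosed_iInter fun s => isClosed_iInter fun t => ?_)
      (isClosed_iInter fun t => ?_)
    · exact isClosed_le ((hev s).dist (hev t)) continuous_const
    · exact isClosed_le ((hev t).dist continuous_const) continuous_const
  have hequi : Equicontinuous ((↑) : A → Icc (0 : ℝ) M → X) := by
    have : UniformEquicontinuous ((↑) : A → Icc (0 : ℝ) M → X) :=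
      LipschitzWith.uniformEquicontinuous _ 1 fun h => h.2.1
    exact this.equicontinuous
  have hcomp : IsCompact A := BoundedContinuousFunction.arzela_ascoli₂ (closedBall x (B + M))
    (isCompact_closedBall x (B + M)) A hclosed (fun h t hh => hh.2 t) hequi
  have hres : ∀ n, LipschitzWith 1 fun t : Icc (0 : ℝ) M => f n t := fun n => by
    simpa [Function.comp_def] using (hf n).comp (LipschitzWith.subtype_val (Icc (0 : ℝ) M))
  let g : ℕ → BoundedContinuousFunction (Icc (0 : ℝ) M) X := fun n =>
    BoundedContinuousFunction.mkOfCompact ⟨fun t => f n t, (hres n).continuous⟩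
  have hg : ∀ n, g n ∈ A := by
    refine fun n => ⟨hres n, fun t => ?_⟩
    have h1 : dist (f n 0) x ≤ B := mem_closedBall.1 (hB (mem_range_self n))
    have h2 : dist (f n t) (f n 0) ≤ M := by
      have := (hf n).dist_le_mul t 0
      simp only [NNReal.coe_one, one_mul, Real.dist_eq, sub_zero, abs_of_nonneg t.2.1] at this
      exact this.trans t.2.2
    exact mem_closedBall.2 ((dist_triangle (f n t) (f n 0) x).trans (by linarith))
  obtain ⟨F, hF, φ, hφ, hlim⟩ := hcomp.tendsto_subseq hg
  refine ⟨fun t => F (projIcc 0 M hM t), ?_, φ, hφ, fun t ht => ?_⟩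
  · simpa [Function.comp_def] using hF.1.comp (LipschitzWith.projIcc hM)
  · have := ((BoundedContinuousFunction.lipschitz_eval_const (⟨t, ht⟩ :
      Icc (0 : ℝ) M)).continuous.tendsto
      F).comp hlim
    simp only [projIcc_of_mem hM ht]
    exact this

/-- Curves of bounded weighted length starting at convergent points subconverge, and the weighted
length is lower semicontinuous, when the weight is lower semicontinuous and at least one. -/
theorem exists_curve_of_tendsto {X : Type*} [MetricSpace X] [ProperSpace X] [MeasurableSpace X]
    [BorelSpace X] {G : X → ℝ≥0∞} (hG : LowerSemicontinuous G) (hG1 : ∀ x, 1 ≤ G x)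
    (γ : ℕ → MCurve X) {x : X} (hx : Tendsto (fun n => (γ n).toFun 0) atTop (𝓝 x))
    {σ : ℕ → ℝ≥0∞} {s S : ℝ≥0∞} (hσ : Tendsto σ atTop (𝓝 s)) (hS : S ≠ ∞)
    (hσS : ∀ n, σ n ≤ S) (hγ : ∀ n, curveLint (γ n) G ≤ σ n) :
    ∃ (γ' : MCurve X) (φ : ℕ → ℕ), StrictMono φ ∧ γ'.toFun 0 = x ∧
      Tendsto (fun n => (γ (φ n)).toFun (γ (φ n)).len) atTop (𝓝 (γ'.toFun γ'.len)) ∧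
      curveLint γ' G ≤ s := by
  choose f hf hfγ using fun n => (γ n).exists_lipschitzWith_eqOn
  have h0 : ∀ n, f n 0 = (γ n).toFun 0 := fun n => hfγ n ⟨le_rfl, (γ n).len_nonneg⟩
  have hlen : ∀ n, (γ n).len ∈ Icc 0 S.toReal := fun n => by
    refine ⟨(γ n).len_nonneg, ?_⟩
    have h1 : ENNReal.ofReal (γ n).len ≤ S := by
      calc ENNReal.ofReal (γ n).len = ∫⁻ _ in Icc (0 : ℝ) (γ n).len, 1 := by simp
        _ ≤ curveLint (γ n) G := lintegral_mono fun t => hG1 _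
        _ ≤ S := (hγ n).trans (hσS n)
    exact (ENNReal.ofReal_le_iff_le_toReal hS).1 h1
  obtain ⟨L, hL, φ, hφ, hφL⟩ := isCompact_Icc.tendsto_subseq hlen
  obtain ⟨F, hF, ψ, hψ, hψF⟩ := exists_subseq_tendsto_of_lipschitzWith (fun n => f (φ n))
    (fun n => hf (φ n)) (x := x)
    (by simpa only [h0, Function.comp_def] using hx.comp hφ.tendsto_atTop)
    (M := S.toReal) ENNReal.toReal_nonneg
  have hLψ : Tendsto (fun n => (γ (φ (ψ n))).len) atTop (𝓝 L) := hφL.comp hψ.tendsto_atTop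
  have hmono : StrictMono fun n => φ (ψ n) := hφ.comp hψ
  refine ⟨MCurve.ofLipschitzWith F hF L hL.1, fun n => φ (ψ n), hmono, ?_, ?_, ?_⟩
  · have h1 := hψF 0 ⟨le_rfl, ENNReal.toReal_nonneg⟩
    have h2 := hx.comp hmono.tendsto_atTop
    refine tendsto_nhds_unique h1 (h2.congr fun n => ?_)
    simp [h0]
  · have h1 := hψF L hL
    have h2 : Tendsto (fun n => dist (f (φ (ψ n)) (γ (φ (ψ n))).len) (f (φ (ψ n)) L))
        atTop (𝓝 0) := by
      have h3 : Tendsto (fun n => dist (γ (φ (ψ n))).len L) atTop (𝓝 0) :=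
        tendsto_iff_dist_tendsto_zero.1 hLψ
      refine squeeze_zero (fun _ => dist_nonneg) (fun n => ?_) h3
      simpa using (hf (φ (ψ n))).dist_le_mul (γ (φ (ψ n))).len L
    have h4 : Tendsto (fun n => f (φ (ψ n)) (γ (φ (ψ n))).len) atTop (𝓝 (F L)) :=
      (tendsto_iff_of_dist h2).2 h1
    refine h4.congr fun n => ?_
    exact hfγ _ ⟨(γ _).len_nonneg, le_rfl⟩
  · have hmeas : ∀ n, Measurable fun t : ℝ =>
        (Icc (0 : ℝ) (γ (φ (ψ n))).len).indicator (fun t => G (f (φ (ψ n)) t)) t := fun n =>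
      (hG.measurable.comp (hf _).continuous.measurable).indicator measurableSet_Icc
    have hpt : ∀ t, (Ico (0 : ℝ) L).indicator (fun t => G (F t)) t ≤
        liminf (fun n => (Icc (0 : ℝ) (γ (φ (ψ n))).len).indicator
          (fun t => G (f (φ (ψ n)) t)) t) atTop := by
      intro t
      by_cases ht : t ∈ Ico (0 : ℝ) L
      · rw [indicator_of_mem ht]
        have h1 : ∀ᶠ n in atTop, (Icc (0 : ℝ) (γ (φ (ψ n))).len).indicator
            (fun t => G (f (φ (ψ n)) t)) t = G (f (φ (ψ n)) t) := by
          filter_upwards [hLψ.eventually (lt_mem_nhds ht.2)] with n hn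
          exact indicator_of_mem (s := Icc (0 : ℝ) _) ⟨ht.1, hn.le⟩ _
        rw [liminf_congr h1]
        refine le_of_forall_lt fun y hy => ?_
        obtain ⟨z, hyz, hz⟩ := exists_between hy
        refine hyz.trans_le (le_liminf_of_le (by isBoundedDefault) ?_)
        filter_upwards [(hψF t ⟨ht.1, ht.2.le.trans hL.2⟩).eventually (hG (F t) z hz)]
          with n hn using hn.le
      · rw [indicator_of_notMem ht]
        exact zero_le
    calc curveLint (MCurve.ofLipschitzWith F hF L hL.1) G
        = ∫⁻ t in Ico (0 : ℝ) L, G (F t) := by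
          unfold curveLint MCurve.ofLipschitzWith
          exact setLIntegral_congr Ico_ae_eq_Icc.symm
      _ = ∫⁻ t, (Ico (0 : ℝ) L).indicator (fun t => G (F t)) t :=
          (lintegral_indicator measurableSet_Ico _).symm
      _ ≤ ∫⁻ t, liminf (fun n => (Icc (0 : ℝ) (γ (φ (ψ n))).len).indicator
          (fun t => G (f (φ (ψ n)) t)) t) atTop := lintegral_mono hpt
      _ ≤ liminf (fun n => ∫⁻ t, (Icc (0 : ℝ) (γ (φ (ψ n))).len).indicator
          (fun t => G (f (φ (ψ n)) t)) t) atTop := lintegral_liminf_le hmeas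
      _ ≤ liminf (fun n => σ (φ (ψ n))) atTop := by
          refine liminf_le_liminf (Eventually.of_forall fun n => ?_)
          rw [lintegral_indicator measurableSet_Icc, ← curveLint_eq_of_eqOn (hfγ _)]
          exact hγ _
      _ = s := (hσ.comp hmono.tendsto_atTop).liminf_eq

/-- The reversed curve. -/
def MCurve.reverse {X : Type*} [MetricSpace X] (γ : MCurve X) : MCurve X where
  len := γ.len
  len_nonneg := γ.len_nonneg
  toFun t := γ.toFun (γ.len - t)
  lip := by
    refine LipschitzOnWith.of_dist_le_mul fun s hs t ht => ?_
    have := γ.lip.dist_le_mul (γ.len - s) ⟨by linarith [hs.2], by linarith [hs.1]⟩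
      (γ.len - t) ⟨by linarith [ht.2], by linarith [ht.1]⟩
    rwa [dist_sub_left] at this

theorem curveLint_reverse {X : Type*} [MetricSpace X] [MeasurableSpace X] (γ : MCurve X)
    (G : X → ℝ≥0∞) : curveLint γ.reverse G = curveLint γ G := by
  have h := (Measure.measurePreserving_sub_left (volume : Measure ℝ)
    γ.len).setLIntegral_comp_preimage_emb
    (MeasurableEquiv.subLeft γ.len).measurableEmbedding (fun t => G (γ.toFun t)) (Icc 0 γ.len)
  simpa [curveLint, MCurve.reverse] using h

/-- The concatenation of two curves. -/
noncomputable def MCurve.concat {X : Type*} [MetricSpace X] (γ₁ γ₂ : MCurve X)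
    (h : γ₁.toFun γ₁.len = γ₂.toFun 0) : MCurve X where
  len := γ₁.len + γ₂.len
  len_nonneg := add_nonneg γ₁.len_nonneg γ₂.len_nonneg
  toFun t := if t ≤ γ₁.len then γ₁.toFun t else γ₂.toFun (t - γ₁.len)
  lip := by
    have key : ∀ s ∈ Icc 0 γ₁.len, ∀ t ∈ Icc γ₁.len (γ₁.len + γ₂.len),
        dist (γ₁.toFun s) (γ₂.toFun (t - γ₁.len)) ≤ t - s := by
      intro s hs t ht
      have h1 := γ₁.lip.dist_le_mul s hs γ₁.len ⟨γ₁.len_nonneg, le_rfl⟩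
      have h2 := γ₂.lip.dist_le_mul 0 ⟨le_rfl, γ₂.len_nonneg⟩ (t - γ₁.len)
        ⟨by linarith [ht.1], by linarith [ht.2]⟩
      rw [h] at h1
      rw [Real.dist_eq, abs_of_nonpos (by linarith [hs.2])] at h1
      rw [Real.dist_eq, abs_of_nonpos (by linarith [ht.1])] at h2
      simp only [NNReal.coe_one, one_mul] at h1 h2
      linarith [dist_triangle (γ₁.toFun s) (γ₂.toFun 0) (γ₂.toFun (t - γ₁.len))]
    refine LipschitzOnWith.of_dist_le_mul fun s hs t ht => ?_
    by_cases hs1 : s ≤ γ₁.len <;> by_cases ht1 : t ≤ γ₁.len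
    · simpa [hs1, ht1] using γ₁.lip.dist_le_mul s ⟨hs.1, hs1⟩ t ⟨ht.1, ht1⟩
    · have := key s ⟨hs.1, hs1⟩ t ⟨(not_le.1 ht1).le, ht.2⟩
      simpa [hs1, ht1, Real.dist_eq, abs_sub_comm s t] using this.trans (le_abs_self _)
    · have := key t ⟨ht.1, ht1⟩ s ⟨(not_le.1 hs1).le, hs.2⟩
      rw [dist_comm] at this
      simpa [hs1, ht1, Real.dist_eq] using this.trans (le_abs_self _)
    · have := γ₂.lip.dist_le_mul (s - γ₁.len) ⟨by linarith, by linarith [hs.2]⟩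
        (t - γ₁.len) ⟨by linarith, by linarith [ht.2]⟩
      rw [dist_sub_right] at this
      simpa [hs1, ht1] using this

theorem MCurve.concat_zero {X : Type*} [MetricSpace X] (γ₁ γ₂ : MCurve X)
    (h : γ₁.toFun γ₁.len = γ₂.toFun 0) : (γ₁.concat γ₂ h).toFun 0 = γ₁.toFun 0 := by
  simp [MCurve.concat, γ₁.len_nonneg]

theorem MCurve.concat_add {X : Type*} [MetricSpace X] (γ₁ γ₂ : MCurve X)
    (h : γ₁.toFun γ₁.len = γ₂.toFun 0) {t : ℝ} (ht : 0 ≤ t) :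
    (γ₁.concat γ₂ h).toFun (t + γ₁.len) = γ₂.toFun t := by
  rcases ht.eq_or_lt with rfl | ht
  · simp [MCurve.concat, h]
  · simp [MCurve.concat, not_le.2 ht]

theorem MCurve.concat_len {X : Type*} [MetricSpace X] (γ₁ γ₂ : MCurve X)
    (h : γ₁.toFun γ₁.len = γ₂.toFun 0) :
    (γ₁.concat γ₂ h).toFun (γ₁.concat γ₂ h).len = γ₂.toFun γ₂.len := by
  rw [← γ₁.concat_add γ₂ h γ₂.len_nonneg, add_comm]
  rfl

theorem curveLint_concat_le {X : Type*} [MetricSpace X] [MeasurableSpace X] (γ₁ γ₂ : MCurve X)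
    (h : γ₁.toFun γ₁.len = γ₂.toFun 0) (G : X → ℝ≥0∞) :
    curveLint (γ₁.concat γ₂ h) G ≤ curveLint γ₁ G + curveLint γ₂ G := by
  have hsplit : Icc (0 : ℝ) (γ₁.len + γ₂.len) =
      Icc 0 γ₁.len ∪ Icc γ₁.len (γ₁.len + γ₂.len) :=
    (Icc_union_Icc_eq_Icc γ₁.len_nonneg (by linarith [γ₂.len_nonneg])).symm
  have h1 : ∫⁻ t in Icc 0 γ₁.len, G ((γ₁.concat γ₂ h).toFun t) = curveLint γ₁ G :=
    setLIntegral_congr_fun measurableSet_Icc fun t ht => by simp [MCurve.concat, ht.2]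
  have h2 : ∫⁻ t in Icc γ₁.len (γ₁.len + γ₂.len), G ((γ₁.concat γ₂ h).toFun t) =
      curveLint γ₂ G := by
    have h3 := (measurePreserving_add_right (volume : Measure ℝ)
      γ₁.len).setLIntegral_comp_preimage_emb
      (MeasurableEquiv.addRight γ₁.len).measurableEmbedding
      (fun t => G ((γ₁.concat γ₂ h).toFun t)) (Icc γ₁.len (γ₁.len + γ₂.len))
    rw [← h3, preimage_add_const_Icc, sub_self, add_sub_cancel_left]
    exact setLIntegral_congr_fun measurableSet_Icc fun t ht => by
      simp only [γ₁.concat_add γ₂ h ht.1]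
  calc curveLint (γ₁.concat γ₂ h) G
      = ∫⁻ t in Icc 0 γ₁.len ∪ Icc γ₁.len (γ₁.len + γ₂.len), G ((γ₁.concat γ₂ h).toFun t) := by
        rw [← hsplit]; rfl
    _ ≤ _ := lintegral_union_le _ _ _
    _ = _ := by rw [h1, h2]

/-- The infimal `G`-weighted length of curves from `x` to the set `K`. -/
noncomputable def pathDist {X : Type*} [MetricSpace X] [MeasurableSpace X] (G : X → ℝ≥0∞)
    (K : Set X) (x : X) : ℝ≥0∞ :=
  ⨅ (γ : MCurve X) (_ : γ.toFun 0 = x ∧ γ.toFun γ.len ∈ K), curveLint γ G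

theorem pathDist_le {X : Type*} [MetricSpace X] [MeasurableSpace X] (G : X → ℝ≥0∞)
    {K : Set X} (γ : MCurve X) (h : γ.toFun γ.len ∈ K) :
    pathDist G K (γ.toFun 0) ≤ curveLint γ G :=
  iInf₂_le γ ⟨rfl, h⟩

theorem pathDist_eq_zero {X : Type*} [MetricSpace X] [MeasurableSpace X] (G : X → ℝ≥0∞)
    {K : Set X} {x : X} (hx : x ∈ K) : pathDist G K x = 0 := by
  refine le_antisymm ?_ zero_le
  refine (pathDist_le G
    (MCurve.ofLipschitzWith (fun _ => x) (LipschitzWith.const' x) 0 le_rfl) hx).trans ?_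
  simp [curveLint, MCurve.ofLipschitzWith]

theorem exists_curve_lt_of_pathDist_lt {X : Type*} [MetricSpace X] [MeasurableSpace X]
    {G : X → ℝ≥0∞} {K : Set X} {x : X} {s : ℝ≥0∞} (h : pathDist G K x < s) :
    ∃ γ : MCurve X, γ.toFun 0 = x ∧ γ.toFun γ.len ∈ K ∧ curveLint γ G < s := by
  simp only [pathDist, iInf_lt_iff] at h
  obtain ⟨γ, hγ, hs⟩ := h
  exact ⟨γ, hγ.1, hγ.2, hs⟩

theorem pathDist_start_le {X : Type*} [MetricSpace X] [MeasurableSpace X] (G : X → ℝ≥0∞)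
    (K : Set X) (γ : MCurve X) :
    pathDist G K (γ.toFun 0) ≤ curveLint γ G + pathDist G K (γ.toFun γ.len) := by
  refine le_of_forall_gt fun s hs => ?_
  by_cases hfin : curveLint γ G = ∞
  · simp [hfin] at hs
  obtain ⟨γ', h0, h1, h2⟩ := exists_curve_lt_of_pathDist_lt
    (lt_tsub_iff_left.2 hs)
  calc pathDist G K (γ.toFun 0) ≤ curveLint (γ.concat γ' h0.symm) G :=
        iInf₂_le (γ.concat γ' h0.symm) ⟨γ.concat_zero γ' h0.symm, by rwa [MCurve.concat_len]⟩
    _ ≤ curveLint γ G + curveLint γ' G := curveLint_concat_le _ _ _ _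
    _ < s := by rw [add_comm]; exact lt_tsub_iff_right.1 h2

theorem pathDist_end_le {X : Type*} [MetricSpace X] [MeasurableSpace X] (G : X → ℝ≥0∞)
    (K : Set X) (γ : MCurve X) :
    pathDist G K (γ.toFun γ.len) ≤ curveLint γ G + pathDist G K (γ.toFun 0) := by
  have := pathDist_start_le G K γ.reverse
  rw [curveLint_reverse] at this
  simpa [MCurve.reverse] using this

theorem lowerSemicontinuous_pathDist {X : Type*} [MetricSpace X] [ProperSpace X]
    [MeasurableSpace X] [BorelSpace X] {G : X → ℝ≥0∞} (hG : LowerSemicontinuous G)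
    (hG1 : ∀ x, 1 ≤ G x) {K : Set X} (hK : IsClosed K) :
    LowerSemicontinuous (pathDist G K) := by
  refine lowerSemicontinuous_iff_isClosed_preimage.2 fun s => ?_
  by_cases hs : s = ∞
  · simp [hs]
  refine IsSeqClosed.isClosed fun x y hx hxy => ?_
  have hlt : ∀ n : ℕ, pathDist G K (x n) < s + ((n : ℝ≥0∞) + 1)⁻¹ := fun n =>
    lt_of_le_of_lt (hx n) (ENNReal.lt_add_right hs (by simp))
  choose γ h0 h1 h2 using fun n => exists_curve_lt_of_pathDist_lt (hlt n)
  have hσ : Tendsto (fun n : ℕ => s + ((n : ℝ≥0∞) + 1)⁻¹) atTop (𝓝 s) := by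
    have := (ENNReal.tendsto_inv_nat_nhds_zero.comp (tendsto_add_atTop_nat 1))
    simpa using tendsto_const_nhds (x := s).add this
  obtain ⟨γ', φ, -, hst, hend, hle⟩ := exists_curve_of_tendsto hG hG1 γ (x := y)
    (by simpa only [h0] using hxy) hσ (S := s + 1) (by simp [hs])
    (fun n => by gcongr; simp) (fun n => (h2 n).le)
  rw [← hst]
  exact (pathDist_le G γ' (hK.mem_of_tendsto hend (Eventually.of_forall fun n => h1 _))).trans hle

/-- If every closed ball around `b` is within weighted distance `s` of `a`, then `a` and `b` are
joined by a curve of weighted length at most `s`. -/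
theorem exists_curve_le_of_pathDist_closedBall_le {X : Type*} [MetricSpace X] [ProperSpace X]
    [MeasurableSpace X] [BorelSpace X] {G : X → ℝ≥0∞} (hG : LowerSemicontinuous G)
    (hG1 : ∀ x, 1 ≤ G x) {a b : X} {s : ℝ≥0∞} (hs : s ≠ ∞)
    (h : ∀ δ : ℝ, 0 < δ → pathDist G (closedBall b δ) a ≤ s) :
    ∃ γ : MCurve X, γ.toFun 0 = a ∧ γ.toFun γ.len = b ∧ curveLint γ G ≤ s := by
  have hlt : ∀ n : ℕ, pathDist G (closedBall b (1 / ((n : ℝ) + 1))) a <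
      s + ((n : ℝ≥0∞) + 1)⁻¹ := fun n =>
    lt_of_le_of_lt (h _ (by positivity)) (ENNReal.lt_add_right hs (by simp))
  choose γ h0 h1 h2 using fun n => exists_curve_lt_of_pathDist_lt (hlt n)
  have hσ : Tendsto (fun n : ℕ => s + ((n : ℝ≥0∞) + 1)⁻¹) atTop (𝓝 s) := by
    have := (ENNReal.tendsto_inv_nat_nhds_zero.comp (tendsto_add_atTop_nat 1))
    simpa using tendsto_const_nhds (x := s).add this
  obtain ⟨γ', φ, hφ, hst, hend, hle⟩ := exists_curve_of_tendsto hG hG1 γ (x := a)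
    (by simp only [h0]; exact tendsto_const_nhds) hσ (S := s + 1) (by simp [hs])
    (fun n => by gcongr; simp) (fun n => (h2 n).le)
  refine ⟨γ', hst, tendsto_nhds_unique hend ?_, hle⟩
  refine tendsto_iff_dist_tendsto_zero.2 (squeeze_zero (fun _ => dist_nonneg)
    (fun n => mem_closedBall.1 (h1 _)) ?_)
  exact (tendsto_one_div_add_atTop_nhds_zero_nat (𝕜 := ℝ)).comp hφ.tendsto_atTop

/-- The Poincaré inequality and the lower mass bound control the difference of averages over
comparable nested balls. -/
theorem abs_setAverage_sub_setAverage_le {X : Type*} [MetricSpace X] [MeasurableSpace X]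
    [BorelSpace X] {μ : Measure X}
    (hpos : ∀ (x : X) (r : ℝ), 0 < r → 0 < μ (ball x r) ∧ μ (ball x r) < ∞)
    {p Q CP τ c : ℝ} (hp : 0 < p) (hCP : 0 < CP) (hτ : 1 ≤ τ) (hPI : WeakPoincare μ p CP τ)
    (hc : 0 < c)
    (hLMB : ∀ (x : X) (r : ℝ), 0 < r → ENNReal.ofReal (c * r ^ Q) ≤ μ (ball x r))
    {h : X → ℝ} (hh : Measurable h) {M : ℝ} (hM : ∀ x, |h x| ≤ M)
    {G : X → ℝ≥0∞} (hG : Measurable G) (hhG : IsWeakUpperGradient μ p h G)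
    {W : Set X} (hW : (∫⁻ x in W, G x ^ p ∂μ) ≠ ∞)
    {y z : X} {s t D : ℝ} (hs : 0 < s) (ht : 0 < t) (hsub : ball y s ⊆ ball z t)
    (hzW : ball z (τ * t) ⊆ W) (hD : 0 ≤ D)
    (hμ : μ (ball z t) ≤ ENNReal.ofReal D * μ (ball y s)) :
    |(⨍ x in ball y s, h x ∂μ) - ⨍ x in ball z t, h x ∂μ| ≤
      D * (CP * ((∫⁻ x in W, G x ^ p ∂μ).toReal / c) ^ (1 / p)) * t ^ (1 - Q / p) := by
  set A := ⨍ x in ball z t, h x ∂μ with hA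
  set I := (∫⁻ x in W, G x ^ p ∂μ).toReal with hI
  have hI0 : 0 ≤ I := ENNReal.toReal_nonneg
  have hτt : 0 < τ * t := by positivity
  have htτ : t ≤ τ * t := le_mul_of_one_le_left ht.le hτ
  have hy := hpos y s hs
  have hz := hpos z t ht
  have h1 : ENNReal.ofReal |(⨍ x in ball y s, h x ∂μ) - A| ≤
      (∫⁻ x in ball y s, ENNReal.ofReal |h x - A| ∂μ) / μ (ball y s) := by
    have hfin : IsFiniteMeasure (μ.restrict (ball y s)) := ⟨by simpa using hy.2⟩
    have hint : Integrable h (μ.restrict (ball y s)) :=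
      Integrable.of_bound hh.aestronglyMeasurable M (Eventually.of_forall fun x => hM x)
    have hne : NeZero (μ.restrict (ball y s)) := ⟨fun h0 => hy.1.ne' (by
      simpa using congrArg (fun m : Measure X => m univ) h0)⟩
    have h2 : (⨍ x in ball y s, h x ∂μ) - A = ⨍ x in ball y s, (h x - A) ∂μ := by
      rw [average_eq, average_eq, integral_sub hint (integrable_const _)]
      simp only [integral_const, smul_eq_mul, measureReal_restrict_apply_univ]
      have : μ.real (ball y s) ≠ 0 := (ENNReal.toReal_pos hy.1.ne' hy.2.ne).ne'
      field_simp
    rw [h2]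
    unfold average
    calc ENNReal.ofReal |∫ x, (h x - A) ∂((μ.restrict (ball y s)) univ)⁻¹ • μ.restrict (ball y s)|
        = ‖∫ x, (h x - A) ∂((μ.restrict (ball y s)) univ)⁻¹ • μ.restrict (ball y s)‖ₑ :=
          (Real.enorm_eq_ofReal_abs _).symm
      _ ≤ ∫⁻ x, ‖h x - A‖ₑ ∂((μ.restrict (ball y s)) univ)⁻¹ • μ.restrict (ball y s) :=
          enorm_integral_le_lintegral_enorm _
      _ = _ := by
          rw [lintegral_smul_measure, Measure.restrict_apply_univ, smul_eq_mul,
            ENNReal.div_eq_inv_mul]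
          simp only [Real.enorm_eq_ofReal_abs]
  have h2 : (∫⁻ x in ball y s, ENNReal.ofReal |h x - A| ∂μ) / μ (ball y s) ≤
      ENNReal.ofReal D *
        ((∫⁻ x in ball z t, ENNReal.ofReal |h x - A| ∂μ) / μ (ball z t)) := by
    have h3 : (μ (ball y s))⁻¹ ≤ ENNReal.ofReal D * (μ (ball z t))⁻¹ := by
      rw [← div_eq_mul_inv, ENNReal.le_div_iff_mul_le (Or.inl hz.1.ne') (Or.inl hz.2.ne),
        mul_comm, ← div_eq_mul_inv]
      exact ENNReal.div_le_of_le_mul hμ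
    calc (∫⁻ x in ball y s, ENNReal.ofReal |h x - A| ∂μ) / μ (ball y s)
        ≤ (∫⁻ x in ball z t, ENNReal.ofReal |h x - A| ∂μ) *
            (ENNReal.ofReal D * (μ (ball z t))⁻¹) := by
          rw [div_eq_mul_inv]
          exact mul_le_mul' (lintegral_mono_set hsub) h3
      _ = _ := by rw [div_eq_mul_inv]; ring
  have h3 : (∫⁻ x in ball z (τ * t), G x ^ p ∂μ) / μ (ball z (τ * t)) ≤
      ENNReal.ofReal (I / (c * t ^ Q)) := by
    rw [ENNReal.ofReal_div_of_pos (by positivity), hI, ENNReal.ofReal_toReal hW]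
    exact ENNReal.div_le_div (lintegral_mono_set hzW)
      ((hLMB z t ht).trans (measure_mono (ball_subset_ball htτ)))
  have h4 : ENNReal.ofReal |(⨍ x in ball y s, h x ∂μ) - A| ≤
      ENNReal.ofReal (D * (CP * t * (I / (c * t ^ Q)) ^ (1 / p))) := by
    rw [ENNReal.ofReal_mul hD, ENNReal.ofReal_mul (by positivity),
      ← ENNReal.ofReal_rpow_of_nonneg (by positivity) (by positivity)]
    refine (h1.trans h2).trans (mul_le_mul' le_rfl ((hPI h G hG hhG z t ht).trans ?_))
    exact mul_le_mul' le_rfl (ENNReal.rpow_le_rpow h3 (by positivity))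
  rw [ENNReal.ofReal_le_ofReal_iff (by positivity)] at h4
  refine h4.trans_eq ?_
  have h5 : (I / (c * t ^ Q)) ^ (1 / p) = (I / c) ^ (1 / p) * t ^ (-(Q / p)) := by
    rw [← div_div, Real.div_rpow (by positivity) (by positivity), ← Real.rpow_mul ht.le,
      Real.rpow_neg ht.le, div_eq_mul_inv]
    congr 3
    ring
  rw [h5, sub_eq_add_neg, Real.rpow_add ht, Real.rpow_one]
  ring

/-- Telescoping of averages over balls shrinking to a point. -/
theorem abs_setAverage_sub_le_of_eventually_eq {X : Type*} [MetricSpace X] [MeasurableSpace X]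
    [BorelSpace X] {μ : Measure X} {Cμ τ K β : ℝ} (hβ : 0 < β) (hCμ : 0 ≤ Cμ)
    (hτ : 1 ≤ τ)
    (hdoub : ∀ (x : X) (r : ℝ), 0 < r →
      μ (ball x (2 * r)) ≤ ENNReal.ofReal Cμ * μ (ball x r))
    {h : X → ℝ} {W : Set X}
    (H : ∀ (y z : X) (s t D : ℝ), 0 < s → 0 < t → ball y s ⊆ ball z t → ball z (τ * t) ⊆ W →
      0 ≤ D → μ (ball z t) ≤ ENNReal.ofReal D * μ (ball y s) →
      |(⨍ x in ball y s, h x ∂μ) - ⨍ x in ball z t, h x ∂μ| ≤ D * K * t ^ β)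
    (hpos : ∀ (x : X) (r : ℝ), 0 < r → 0 < μ (ball x r) ∧ μ (ball x r) < ∞)
    {a : X} {R v : ℝ} (hR : 0 < R) (haW : ball a (τ * R) ⊆ W)
    (hv : ∃ δ : ℝ, 0 < δ ∧ ∀ x ∈ ball a δ, h x = v) :
    |(⨍ x in ball a R, h x ∂μ) - v| ≤ Cμ * K * R ^ β / (1 - (1 / 2 : ℝ) ^ β) := by
  have hrad : ∀ k : ℕ, 0 < R * (1 / 2 : ℝ) ^ k := fun k => by positivity
  have hstep : ∀ k : ℕ, dist (⨍ x in ball a (R * (1 / 2 : ℝ) ^ k), h x ∂μ)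
      (⨍ x in ball a (R * (1 / 2 : ℝ) ^ (k + 1)), h x ∂μ) ≤
      Cμ * K * R ^ β * ((1 / 2 : ℝ) ^ β) ^ k := by
    intro k
    have hle : R * (1 / 2 : ℝ) ^ k ≤ R :=
      mul_le_of_le_one_right hR.le (pow_le_one₀ (by norm_num) (by norm_num))
    have hk : R * (1 / 2 : ℝ) ^ k = 2 * (R * (1 / 2 : ℝ) ^ (k + 1)) := by
      rw [pow_succ]; ring
    have h1 := H a a _ _ Cμ (hrad (k + 1)) (hrad k)
      (ball_subset_ball (by rw [hk]; linarith [hrad (k + 1)]))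
      ((ball_subset_ball (by gcongr)).trans haW) hCμ (by
        rw [hk]; exact hdoub a _ (hrad (k + 1)))
    rw [dist_comm, Real.dist_eq]
    refine h1.trans_eq ?_
    rw [Real.mul_rpow hR.le (by positivity), ← Real.rpow_natCast, ← Real.rpow_natCast,
      ← Real.rpow_mul (by norm_num), ← Real.rpow_mul (by norm_num), mul_comm (k : ℝ) β]
    ring
  have hlim : Tendsto (fun k : ℕ => ⨍ x in ball a (R * (1 / 2 : ℝ) ^ k), h x ∂μ) atTop (𝓝 v) := by
    obtain ⟨δ, hδ, hv⟩ := hv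
    have h1 : Tendsto (fun k : ℕ => R * (1 / 2 : ℝ) ^ k) atTop (𝓝 0) := by
      simpa using (tendsto_pow_atTop_nhds_zero_of_lt_one (r := (1 / 2 : ℝ))
        (by norm_num) (by norm_num)).const_mul R
    refine tendsto_const_nhds.congr' ?_
    filter_upwards [h1.eventually (gt_mem_nhds hδ)] with k hk
    have h2 := hpos a _ (hrad k)
    rw [setAverage_congr_fun measurableSet_ball
      (Eventually.of_forall fun x hx => hv x (ball_subset_ball hk.le hx)),
      setAverage_const h2.1.ne' h2.2.ne]
  have hlt : (1 / 2 : ℝ) ^ β < 1 := Real.rpow_lt_one (by norm_num) (by norm_num) hβ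
  have := dist_le_of_le_geometric_of_tendsto₀ _ _ hlt hstep hlim
  simpa [Real.dist_eq] using this

/-- The truncated weighted distance to a set has the weight as an upper gradient. -/
theorem isWeakUpperGradient_toReal_min_pathDist {X : Type*} [MetricSpace X] [MeasurableSpace X]
    (μ : Measure X) {p : ℝ} (hp : 0 < p) (G : X → ℝ≥0∞) (K : Set X) {M : ℝ≥0∞} (hM : M ≠ ∞) :
    IsWeakUpperGradient μ p (fun x => (min M (pathDist G K x)).toReal) G := by
  refine ⟨∅, ?_, fun γ _ => ?_⟩
  · refine le_antisymm ?_ zero_le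
    refine (iInf₂_le (fun _ => 0) measurable_const).trans ?_
    simp [hp]
  · have hfin : ∀ x, min M (pathDist G K x) ≠ ∞ := fun x =>
      ne_top_of_le_ne_top hM (min_le_left _ _)
    have key : ∀ x y, pathDist G K x ≤ curveLint γ G + pathDist G K y →
        min M (pathDist G K x) ≤ curveLint γ G + min M (pathDist G K y) := by
      intro x y hxy
      rw [← min_add_add_left]
      exact min_le_min le_add_self hxy
    by_cases hc : curveLint γ G = ∞
    · simp [hc]
    have key' : ∀ x y, pathDist G K x ≤ curveLint γ G + pathDist G K y →
        (min M (pathDist G K x)).toReal - (min M (pathDist G K y)).toReal ≤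
          (curveLint γ G).toReal := by
      intro x y hxy
      have := ENNReal.toReal_mono (by simp [hc, hM]) (key x y hxy)
      rw [ENNReal.toReal_add hc (hfin y)] at this
      linarith
    rw [edist_dist, ← ENNReal.ofReal_toReal hc]
    refine ENNReal.ofReal_le_ofReal ?_
    rw [Real.dist_eq, abs_le]
    have h1 := key' _ _ (pathDist_start_le G K γ)
    have h2 := key' _ _ (pathDist_end_le G K γ)
    constructor <;> linarith

/-- Morrey-type bound for the weighted distance from a point to a small closed ball. -/
theorem pathDist_closedBall_le {X : Type*} [MetricSpace X] [ProperSpace X] [MeasurableSpace X]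
    [BorelSpace X] {μ : Measure X}
    (hpos : ∀ (x : X) (r : ℝ), 0 < r → 0 < μ (ball x r) ∧ μ (ball x r) < ∞)
    {Cμ : ℝ} (hCμ : 0 ≤ Cμ)
    (hdoub : ∀ (x : X) (r : ℝ), 0 < r →
      μ (ball x (2 * r)) ≤ ENNReal.ofReal Cμ * μ (ball x r))
    {p Q CP τ c : ℝ} (hp : 0 < p) (hQp : Q < p) (hCP : 0 < CP) (hτ : 1 ≤ τ)
    (hPI : WeakPoincare μ p CP τ) (hc : 0 < c)
    (hLMB : ∀ (x : X) (r : ℝ), 0 < r → ENNReal.ofReal (c * r ^ Q) ≤ μ (ball x r))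
    {G : X → ℝ≥0∞} (hG : LowerSemicontinuous G) (hG1 : ∀ x, 1 ≤ G x)
    {x a b : X} {r : ℝ} (ha : a ∈ ball x r) (hb : b ∈ ball x r)
    (hI : (∫⁻ y in ball x (5 * τ * r), G y ^ p ∂μ) ≠ ∞) {δ : ℝ} (hδ : 0 < δ) :
    pathDist G (closedBall b δ) a ≤
      ENNReal.ofReal ((2 * Cμ / (1 - (1 / 2 : ℝ) ^ (1 - Q / p)) + Cμ ^ 2) *
        (CP * ((∫⁻ y in ball x (5 * τ * r), G y ^ p ∂μ).toReal / c) ^ (1 / p)) *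
          (4 * r) ^ (1 - Q / p)) := by
  set W := ball x (5 * τ * r) with hWdef
  set K := CP * ((∫⁻ y in W, G y ^ p ∂μ).toReal / c) ^ (1 / p) with hKdef
  set β := 1 - Q / p with hβdef
  have hr : 0 < r := pos_of_mem_ball ha
  have hK : 0 ≤ K := by positivity
  have hβ : 0 < β := by
    have := (div_lt_one hp).2 hQp
    linarith
  have hlt : (1 / 2 : ℝ) ^ β < 1 := Real.rpow_lt_one (by norm_num) (by norm_num) hβ
  by_contra! hcon
  obtain ⟨v, -, hSv, hvd⟩ := ENNReal.lt_iff_exists_real_btwn.1 hcon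
  have hSv' := (ENNReal.ofReal_lt_ofReal_iff'.1 hSv).1
  have hv0 : 0 < v := (ENNReal.ofReal_lt_ofReal_iff'.1 hSv).2
  have hlsc := lowerSemicontinuous_pathDist hG hG1 (isClosed_closedBall (x := b) (ε := δ))
  set h : X → ℝ := fun y => (min (ENNReal.ofReal v) (pathDist G (closedBall b δ) y)).toReal
    with hhdef
  have hmeas : Measurable h := (measurable_const.min hlsc.measurable).ennreal_toReal
  have hbound : ∀ y, |h y| ≤ v := by
    intro y
    rw [abs_of_nonneg ENNReal.toReal_nonneg]
    exact ENNReal.toReal_le_of_le_ofReal hv0.le (min_le_left _ _)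
  have hug : IsWeakUpperGradient μ p h G :=
    isWeakUpperGradient_toReal_min_pathDist μ hp G _ ENNReal.ofReal_ne_top
  have H : ∀ (y z : X) (s t D : ℝ), 0 < s → 0 < t → ball y s ⊆ ball z t →
      ball z (τ * t) ⊆ W → 0 ≤ D → μ (ball z t) ≤ ENNReal.ofReal D * μ (ball y s) →
      |(⨍ x in ball y s, h x ∂μ) - ⨍ x in ball z t, h x ∂μ| ≤ D * K * t ^ β :=
    fun y z s t D hs ht hsub hzW hD hμ => abs_setAverage_sub_setAverage_le hpos hp hCP hτ hPI hc
      hLMB hmeas hbound hG.measurable hug hI hs ht hsub hzW hD hμ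
  have hax := mem_ball.1 ha
  have hbx := mem_ball.1 hb
  have hτr : r ≤ τ * r := le_mul_of_one_le_left hr.le hτ
  have hab : dist a b < 2 * r := by
    have := dist_triangle_right a b x
    linarith
  have haW : ball a (τ * (4 * r)) ⊆ W := ball_subset_ball' (by linarith)
  have hbW : ball b (τ * (2 * r)) ⊆ W := ball_subset_ball' (by linarith)
  have h1 := abs_setAverage_sub_le_of_eventually_eq hβ hCμ hτ hdoub H hpos (a := a) (v := v)
    (R := 4 * r) (by positivity) haW (by
      obtain ⟨ε, hε, hball⟩ := Metric.eventually_nhds_iff_ball.1 (hlsc a _ hvd)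
      refine ⟨ε, hε, fun y hy => ?_⟩
      simp only [hhdef, min_eq_left (hball y hy).le, ENNReal.toReal_ofReal hv0.le])
  have h2 := abs_setAverage_sub_le_of_eventually_eq hβ hCμ hτ hdoub H hpos (a := b) (v := 0)
    (R := 2 * r) (by positivity) hbW ⟨δ, hδ, fun y hy => by
      simp [hhdef, pathDist_eq_zero G (ball_subset_closedBall hy)]⟩
  have h3 := H b a (2 * r) (4 * r) (Cμ ^ 2) (by positivity) (by positivity)
    (ball_subset_ball' (by rw [dist_comm]; linarith)) haW (by positivity) (by
      calc μ (ball a (4 * r)) ≤ μ (ball b (2 * (2 * (2 * r)))) :=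
            measure_mono (ball_subset_ball' (by linarith))
        _ ≤ ENNReal.ofReal Cμ * (ENNReal.ofReal Cμ * μ (ball b (2 * r))) :=
            (hdoub b _ (by positivity)).trans
              (mul_le_mul' le_rfl (hdoub b _ (by positivity)))
        _ = ENNReal.ofReal (Cμ ^ 2) * μ (ball b (2 * r)) := by
            rw [pow_two, ENNReal.ofReal_mul hCμ, mul_assoc])
  have h4 : Cμ * K * (2 * r) ^ β / (1 - (1 / 2 : ℝ) ^ β) ≤
      Cμ * K * (4 * r) ^ β / (1 - (1 / 2 : ℝ) ^ β) := by
    have : 0 ≤ 1 - (1 / 2 : ℝ) ^ β := by linarith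
    gcongr
    norm_num
  have h5 : (2 * Cμ / (1 - (1 / 2 : ℝ) ^ β) + Cμ ^ 2) * K * (4 * r) ^ β =
      Cμ * K * (4 * r) ^ β / (1 - (1 / 2 : ℝ) ^ β) + Cμ ^ 2 * K * (4 * r) ^ β +
        Cμ * K * (4 * r) ^ β / (1 - (1 / 2 : ℝ) ^ β) := by ring
  rw [h5] at hSv'
  rw [abs_le] at h1 h2 h3
  linarith [h1.1, h2.2, h3.1]

/-- A curve family of modulus zero is annihilated by a single weight of small energy. -/
theorem exists_curveLint_eq_top_of_pModulus_eq_zero {X : Type*} [MetricSpace X]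
    [MeasurableSpace X] {μ : Measure X} {p : ℝ} (hp : 0 < p) {Γ : Set (MCurve X)}
    (hΓ : pModulus μ p Γ = 0) {η : ℝ≥0∞} (hη : η ≠ 0) :
    ∃ Ψ : X → ℝ≥0∞, Measurable Ψ ∧ (∫⁻ x, Ψ x ∂μ) ≤ η ∧
      ∀ γ ∈ Γ, curveLint γ (fun x => Ψ x ^ (1 / p)) = ∞ := by
  obtain ⟨ε, hε, hεη⟩ := ENNReal.exists_pos_sum_of_countable' hη ℕ
  have hk : ∀ k : ℕ, ∃ ρ : X → ℝ≥0∞, Measurable ρ ∧ (∀ γ ∈ Γ, 1 ≤ curveLint γ ρ) ∧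
      (∫⁻ x, (((k : ℝ≥0∞) + 1) * ρ x) ^ p ∂μ) ≤ ε k := by
    intro k
    have hk0 : ((k : ℝ≥0∞) + 1) ^ p ≠ 0 := by simp
    have hkt : ((k : ℝ≥0∞) + 1) ^ p ≠ ∞ := ENNReal.rpow_ne_top_of_nonneg hp.le (by simp)
    have hlt : pModulus μ p Γ < ε k / ((k : ℝ≥0∞) + 1) ^ p := by
      rw [hΓ]
      exact ENNReal.div_pos (hε k).ne' hkt
    simp only [pModulus, iInf_lt_iff] at hlt
    obtain ⟨ρ, hρ, hadm, hlt⟩ := hlt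
    refine ⟨ρ, hρ, hadm, ?_⟩
    simp only [ENNReal.mul_rpow_of_nonneg _ _ hp.le]
    rw [lintegral_const_mul _ (hρ.pow_const p), mul_comm]
    exact (ENNReal.le_div_iff_mul_le (Or.inl hk0) (Or.inl hkt)).1 hlt.le
  choose ρ hρ hadm hρε using hk
  have hm : ∀ k : ℕ, Measurable fun x => (((k : ℝ≥0∞) + 1) * ρ k x) ^ p := fun k =>
    ((hρ k).const_mul _).pow_const p
  refine ⟨fun x => ∑' k : ℕ, (((k : ℝ≥0∞) + 1) * ρ k x) ^ p, Measurable.tsum hm, ?_,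
    fun γ hγ => ?_⟩
  · rw [lintegral_tsum fun k => (hm k).aemeasurable]
    exact (ENNReal.tsum_le_tsum hρε).trans hεη.le
  · refine ENNReal.eq_top_of_forall_nnreal_le fun y => ?_
    obtain ⟨k, hk⟩ := exists_nat_ge y
    calc (y : ℝ≥0∞) ≤ ((k : ℝ≥0∞) + 1) * 1 := by
          rw [mul_one]
          exact le_add_right (by exact_mod_cast hk)
      _ ≤ ((k : ℝ≥0∞) + 1) * curveLint γ (ρ k) := mul_le_mul' le_rfl (hadm k γ hγ)
      _ = ∫⁻ t in Icc (0 : ℝ) γ.len, ((k : ℝ≥0∞) + 1) * ρ k (γ.toFun t) :=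
          (lintegral_const_mul' _ _ (by simp)).symm
      _ ≤ _ := lintegral_mono fun t => by
          rw [one_div, ENNReal.le_rpow_inv_iff hp]
          exact ENNReal.le_tsum (f := fun k : ℕ => (((k : ℝ≥0∞) + 1) * ρ k (γ.toFun t)) ^ p) k

/-- A weak upper gradient is dominated by a lower semicontinuous upper gradient that is at least
one and has almost the same energy on every set, up to the volume of the set. -/
theorem IsWeakUpperGradient.exists_lowerSemicontinuous {X Y : Type*} [MetricSpace X]
    [MeasurableSpace X] [BorelSpace X] [PseudoEMetricSpace Y] {μ : Measure X} [SigmaFinite μ]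
    [μ.WeaklyRegular] {p : ℝ} (hp : 0 < p) {u : X → Y} {g : X → ℝ≥0∞} (hg : Measurable g)
    (hgu : IsWeakUpperGradient μ p u g) (hgp : (∫⁻ x, g x ^ p ∂μ) ≠ ∞) {η : ℝ≥0∞} (hη : η ≠ 0)
    (hηt : η ≠ ∞) :
    ∃ G : X → ℝ≥0∞, LowerSemicontinuous G ∧ (∀ x, 1 ≤ G x) ∧ IsUpperGradient u G ∧
      ∀ s : Set X, (∫⁻ x in s, G x ^ p ∂μ) ≤ (∫⁻ x in s, (1 + g x ^ p) ∂μ) + η := by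
  obtain ⟨Γ, hΓ, hγ⟩ := hgu
  have hη2 : η / 2 ≠ 0 := (ENNReal.half_pos hη).ne'
  obtain ⟨Ψ, hΨ, hΨη, hΨΓ⟩ := exists_curveLint_eq_top_of_pModulus_eq_zero hp hΓ hη2
  have hf : Measurable fun x => g x ^ p + Ψ x := (hg.pow_const p).add hΨ
  have hfint : (∫⁻ x, (g x ^ p + Ψ x) ∂μ) ≠ ∞ := by
    rw [lintegral_add_right _ hΨ]
    exact ENNReal.add_ne_top.2 ⟨hgp, ne_top_of_le_ne_top (ENNReal.div_ne_top hηt (by simp)) hΨη⟩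
  obtain ⟨Φ, hfΦ, hΦ, hΦint⟩ := exists_le_lowerSemicontinuous_lintegral_ge μ _ hf hη2
  have hle : ∀ x (y : ℝ≥0∞), y ^ p ≤ Φ x → y ≤ (1 + Φ x) ^ (1 / p) := fun x y hy => by
    rw [one_div, ENNReal.le_rpow_inv_iff hp]
    exact hy.trans le_add_self
  have hinv : ∀ y : ℝ≥0∞, (y ^ (1 / p)) ^ p = y := fun y => by
    rw [← ENNReal.rpow_mul, one_div_mul_cancel hp.ne', ENNReal.rpow_one]
  refine ⟨fun x => (1 + Φ x) ^ (1 / p), ?_, fun x => ?_, fun γ => ?_, fun s => ?_⟩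
  · have h1 : LowerSemicontinuous fun x => 1 + Φ x := lowerSemicontinuous_const.add hΦ
    exact (ENNReal.continuous_rpow_const (y := 1 / p)).comp_lowerSemicontinuous h1
      (ENNReal.monotone_rpow_of_nonneg (by positivity))
  · rw [one_div, ENNReal.le_rpow_inv_iff hp, ENNReal.one_rpow]
    exact le_self_add
  · by_cases hmem : γ ∈ Γ
    · have h1 : curveLint γ (fun x => Ψ x ^ (1 / p)) ≤
          curveLint γ (fun x => (1 + Φ x) ^ (1 / p)) := lintegral_mono fun t =>
        hle _ _ (by rw [hinv]; exact le_add_self.trans (hfΦ _))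
      rw [hΨΓ γ hmem] at h1
      exact le_top.trans h1
    · exact (hγ γ hmem).trans (lintegral_mono fun t => hle _ _ (le_self_add.trans (hfΦ _)))
  · simp only [hinv]
    have h1 : (∫⁻ x, (Φ x - (g x ^ p + Ψ x)) ∂μ) ≤ η / 2 := by
      rw [lintegral_sub hf hfint (Eventually.of_forall hfΦ)]
      exact tsub_le_iff_left.2 hΦint
    calc ∫⁻ x in s, (1 + Φ x) ∂μ
        = ∫⁻ x in s, ((1 + g x ^ p) + (Ψ x + (Φ x - (g x ^ p + Ψ x)))) ∂μ := by
          refine lintegral_congr fun x => ?_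
          conv_lhs => rw [← add_tsub_cancel_of_le (hfΦ x)]
          ring
      _ = (∫⁻ x in s, (1 + g x ^ p) ∂μ) +
            ((∫⁻ x in s, Ψ x ∂μ) + ∫⁻ x in s, (Φ x - (g x ^ p + Ψ x)) ∂μ) := by
          have hm : Measurable fun x => 1 + g x ^ p := measurable_const.add (hg.pow_const p)
          rw [lintegral_add_left hm, lintegral_add_left hΨ]
      _ ≤ (∫⁻ x in s, (1 + g x ^ p) ∂μ) + (η / 2 + η / 2) := by
          gcongr
          · exact (setLIntegral_le_lintegral _ _).trans hΨη
          · exact (setLIntegral_le_lintegral _ _).trans h1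
      _ = _ := by rw [ENNReal.add_halves]

/-- Oscillation bound interpolating between the volume and the energy of a ball. -/
theorem IsWeakUpperGradient.exists_diam_rpow_le {X Y : Type*} [MetricSpace X] [ProperSpace X]
    [MeasurableSpace X] [BorelSpace X] [PseudoEMetricSpace Y] {μ : Measure X}
    (hpos : ∀ (x : X) (r : ℝ), 0 < r → 0 < μ (ball x r) ∧ μ (ball x r) < ∞)
    {Cμ : ℝ} (hCμ : 0 ≤ Cμ)
    (hdoub : ∀ (x : X) (r : ℝ), 0 < r →
      μ (ball x (2 * r)) ≤ ENNReal.ofReal Cμ * μ (ball x r))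
    {p Q CP τ c : ℝ} (hQ : 0 ≤ Q) (hQp : Q < p) (hCP : 0 < CP) (hτ : 1 ≤ τ)
    (hPI : WeakPoincare μ p CP τ) (hc : 0 < c)
    (hLMB : ∀ (x : X) (r : ℝ), 0 < r → ENNReal.ofReal (c * r ^ Q) ≤ μ (ball x r))
    {u : X → Y} {g : X → ℝ≥0∞} (hg : Measurable g) (hgu : IsWeakUpperGradient μ p u g)
    (hgp : (∫⁻ x, g x ^ p ∂μ) ≠ ∞) :
    ∃ C : ℝ≥0∞, C ≠ ∞ ∧ ∀ (x : X) (r : ℝ), 0 < r →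
      ediam (u '' ball x r) ^ Q ≤ C * (μ (ball x (r / 2)) ^ (1 - Q / p) *
        (∫⁻ y in ball x (5 * τ * r), (1 + g y ^ p) ∂μ) ^ (Q / p)) := by
  have hp : 0 < p := hQ.trans_lt hQp
  have hθ : 0 ≤ Q / p := div_nonneg hQ hp.le
  have hβ : 0 < 1 - Q / p := by linarith [(div_lt_one hp).2 hQp]
  have hlt : (1 / 2 : ℝ) ^ (1 - Q / p) < 1 := Real.rpow_lt_one (by norm_num) (by norm_num) hβ
  have hlt' : 0 ≤ 1 - (1 / 2 : ℝ) ^ (1 - Q / p) := by linarith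
  set K := (2 * Cμ / (1 - (1 / 2 : ℝ) ^ (1 - Q / p)) + Cμ ^ 2) * CP * 4 ^ (1 - Q / p) with hKdef
  have hK : 0 ≤ K := by positivity
  have : IsLocallyFiniteMeasure μ := ⟨fun x => ⟨ball x 1, ball_mem_nhds x one_pos,
    (hpos x 1 one_pos).2⟩⟩
  refine ⟨ENNReal.ofReal (K ^ Q) * (ENNReal.ofReal c⁻¹ * 2) ^ (Q / p) *
    ENNReal.ofReal (2 ^ Q / c) ^ (1 - Q / p), ?_, fun x r hr => ?_⟩
  · exact ENNReal.mul_ne_top (ENNReal.mul_ne_top ENNReal.ofReal_ne_top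
      (ENNReal.rpow_ne_top_of_nonneg hθ (ENNReal.mul_ne_top ENNReal.ofReal_ne_top (by simp))))
      (ENNReal.rpow_ne_top_of_nonneg hβ.le ENNReal.ofReal_ne_top)
  set W := ball x (5 * τ * r)
  set J := ∫⁻ y in W, (1 + g y ^ p) ∂μ
  have hW := hpos x (5 * τ * r) (by positivity)
  have hJ : J = μ W + ∫⁻ y in W, g y ^ p ∂μ := by
    simp only [J]
    rw [lintegral_add_left measurable_const, setLIntegral_one]
  have hJ0 : J ≠ 0 := by
    rw [hJ]
    exact (hW.1.trans_le le_self_add).ne'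
  have hJt : J ≠ ∞ := by
    rw [hJ]
    exact ENNReal.add_ne_top.2 ⟨hW.2.ne, ne_top_of_le_ne_top hgp (setLIntegral_le_lintegral _ _)⟩
  obtain ⟨G, hG, hG1, hGu, hGint⟩ := hgu.exists_lowerSemicontinuous hp hg hgp hJ0 hJt
  set I := ∫⁻ y in W, G y ^ p ∂μ
  have hI : I ≤ 2 * J := (hGint W).trans (two_mul J).ge
  have hIt : I ≠ ∞ := ne_top_of_le_ne_top (ENNReal.mul_ne_top (by simp) hJt) hI
  set S := K * (I.toReal / c) ^ (1 / p) * r ^ (1 - Q / p)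
  have hdiam : ediam (u '' ball x r) ≤ ENNReal.ofReal S := by
    refine ediam_le ?_
    rintro _ ⟨b, hb, rfl⟩ _ ⟨a, ha, rfl⟩
    obtain ⟨γ, rfl, rfl, hγ⟩ := exists_curve_le_of_pathDist_closedBall_le hG hG1
      ENNReal.ofReal_ne_top (a := a) (b := b) (s := ENNReal.ofReal S) fun δ hδ => by
        refine (pathDist_closedBall_le hpos hCμ hdoub hp hQp hCP hτ hPI hc hLMB hG hG1 ha hb hIt
          hδ).trans (le_of_eq ?_)
        rw [Real.mul_rpow (by norm_num) hr.le]
        simp only [S, K, I, W]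
        ring_nf
    exact (hGu γ).trans hγ
  have hSQ : ENNReal.ofReal S ^ Q = ENNReal.ofReal (K ^ Q) *
      (ENNReal.ofReal c⁻¹ * I) ^ (Q / p) * ENNReal.ofReal (r ^ Q) ^ (1 - Q / p) := by
    have h1 : ENNReal.ofReal c⁻¹ * I = ENNReal.ofReal (I.toReal / c) := by
      rw [div_eq_inv_mul, ENNReal.ofReal_mul (by positivity), ENNReal.ofReal_toReal hIt]
    rw [h1, ENNReal.ofReal_rpow_of_nonneg (by positivity) hθ,
      ENNReal.ofReal_rpow_of_nonneg (by positivity) hβ.le, ← ENNReal.ofReal_mul (by positivity),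
      ← ENNReal.ofReal_mul (by positivity), ENNReal.ofReal_rpow_of_nonneg (by positivity) hQ]
    congr 1
    rw [Real.mul_rpow (by positivity) (by positivity), Real.mul_rpow hK (by positivity),
      ← Real.rpow_mul (by positivity), ← Real.rpow_mul hr.le, ← Real.rpow_mul hr.le,
      one_div_mul_eq_div, mul_comm Q]
  have hrQ : ENNReal.ofReal (r ^ Q) ≤ ENNReal.ofReal (2 ^ Q / c) * μ (ball x (r / 2)) := by
    refine le_trans (le_of_eq ?_) (mul_le_mul' le_rfl (hLMB x (r / 2) (by positivity)))
    rw [← ENNReal.ofReal_mul (by positivity), Real.div_rpow hr.le (by norm_num)]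
    congr 1
    field_simp
  calc ediam (u '' ball x r) ^ Q ≤ ENNReal.ofReal S ^ Q :=
        ENNReal.rpow_le_rpow hdiam hQ
    _ ≤ ENNReal.ofReal (K ^ Q) * (ENNReal.ofReal c⁻¹ * (2 * J)) ^ (Q / p) *
        (ENNReal.ofReal (2 ^ Q / c) * μ (ball x (r / 2))) ^ (1 - Q / p) := by
      rw [hSQ]
      gcongr
    _ = _ := by
      rw [← mul_assoc, ENNReal.mul_rpow_of_nonneg _ J hθ, ENNReal.mul_rpow_of_nonneg _ _ hβ.le]
      ring

/-- Weak-type estimate over disjoint balls, from the Vitali covering lemma. -/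
theorem mul_sum_measure_closedBall_le {X ι : Type*} [MetricSpace X] [MeasurableSpace X]
    [BorelSpace X] {μ ν : Measure X} {s : Finset ι} {x : ι → X} {r : ι → ℝ} {κ : ℝ}
    {D t : ℝ≥0∞} {W : Set X} (hr : ∀ i ∈ s, 0 ≤ r i) (hκ : 1 ≤ κ)
    (hdisj : (s : Set ι).PairwiseDisjoint fun i => closedBall (x i) (r i))
    (hD : ∀ i ∈ s, μ (closedBall (x i) (5 * (κ * r i))) ≤ D * μ (closedBall (x i) (r i)))
    (hW : ∀ i ∈ s, closedBall (x i) (κ * r i) ⊆ W)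
    (ht : ∀ i ∈ s, t * μ (closedBall (x i) (r i)) ≤ ν (closedBall (x i) (κ * r i))) :
    t * ∑ i ∈ s, μ (closedBall (x i) (r i)) ≤ D * ν W := by
  classical
  obtain ⟨v, hvs, hv, hcov⟩ := Vitali.exists_disjoint_subfamily_covering_enlargement_closedBall
    (s : Set ι) x (fun i => κ * r i) (∑ i ∈ s, κ * r i)
    (fun i hi => Finset.single_le_sum (f := fun i => κ * r i)
      (fun j hj => mul_nonneg (by linarith) (hr j hj)) hi) 5 (by norm_num)
  obtain ⟨w, rfl⟩ : ∃ w : Finset ι, (w : Set ι) = v :=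
    ⟨(s.finite_toSet.subset hvs).toFinset, by simp⟩
  have hws : ∀ i ∈ w, i ∈ s := fun i hi => hvs hi
  calc t * ∑ i ∈ s, μ (closedBall (x i) (r i))
      = t * μ (⋃ i ∈ s, closedBall (x i) (r i)) := by
        rw [measure_biUnion_finset hdisj fun i _ => measurableSet_closedBall]
    _ ≤ t * μ (⋃ j ∈ w, closedBall (x j) (5 * (κ * r j))) := by
        refine mul_le_mul' le_rfl (measure_mono (iUnion₂_subset fun i hi => ?_))
        obtain ⟨j, hj, hsub⟩ := hcov i hi
        refine (closedBall_subset_closedBall (le_mul_of_one_le_left (hr i hi) hκ)).trans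
          (hsub.trans ?_)
        exact subset_biUnion_of_mem (u := fun j => closedBall (x j) (5 * (κ * r j))) hj
    _ ≤ t * ∑ j ∈ w, D * μ (closedBall (x j) (r j)) := by
        gcongr
        exact (measure_biUnion_finset_le _ _).trans
          (Finset.sum_le_sum fun j hj => hD j (hws j hj))
    _ = D * ∑ j ∈ w, t * μ (closedBall (x j) (r j)) := by
        rw [← Finset.mul_sum, ← Finset.mul_sum]
        ring
    _ ≤ D * ∑ j ∈ w, ν (closedBall (x j) (κ * r j)) := by
        gcongr with j hj
        exact ht j (hws j hj)
    _ = D * ν (⋃ j ∈ w, closedBall (x j) (κ * r j)) := by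
        rw [measure_biUnion_finset hv fun i _ => measurableSet_closedBall]
    _ ≤ D * ν W := by
        gcongr
        exact iUnion₂_subset fun j hj => hW j (hws j hj)

/-- A weak-type bound controls interpolated sums, up to a multiple of the total mass. -/
theorem sum_rpow_mul_rpow_le {ι : Type*} {s : Finset ι} {a m : ι → ℝ≥0∞} {θ : ℝ} {M : ℝ≥0∞}
    (hθ0 : 0 ≤ θ) (hθ1 : θ < 1) (ha : ∀ i ∈ s, a i ≠ 0) (hm : ∀ i ∈ s, m i ≠ ∞)
    (hM : ∀ t : ℝ≥0∞, t * ∑ i ∈ s with t * a i ≤ m i, a i ≤ M) (n : ℕ) :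
    ∑ i ∈ s, a i ^ (1 - θ) * m i ^ θ ≤ (2 ^ n) ^ θ * ∑ i ∈ s, a i +
      2 ^ θ * M * ((2 ^ (θ - 1)) ^ n * (1 - 2 ^ (θ - 1))⁻¹) := by
  classical
  have key : ∀ {b y z : ℝ≥0∞}, z ≤ b * y → y ^ (1 - θ) * z ^ θ ≤ b ^ θ * y := by
    intro b y z h
    calc y ^ (1 - θ) * z ^ θ ≤ y ^ (1 - θ) * (b * y) ^ θ := by gcongr
      _ = b ^ θ * (y ^ (1 - θ) * y ^ θ) := by
          rw [ENNReal.mul_rpow_of_nonneg _ _ hθ0]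
          ring
      _ = b ^ θ * y := by
          rw [← ENNReal.rpow_add_of_nonneg _ _ (by linarith) hθ0, sub_add_cancel, ENNReal.rpow_one]
  have hpt : ∀ i ∈ s, a i ^ (1 - θ) * m i ^ θ ≤ (2 ^ n) ^ θ * a i +
      ∑' k : ℕ, if 2 ^ (n + k) * a i ≤ m i then (2 ^ (n + k + 1)) ^ θ * a i else 0 := by
    intro i hi
    by_cases h : m i ≤ 2 ^ n * a i
    · exact (key h).trans le_self_add
    have hex : ∃ k : ℕ, m i ≤ 2 ^ (n + k + 1) * a i := by
      obtain ⟨k, hk⟩ := ENNReal.exists_nat_mul_gt (ha i hi) (hm i hi)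
      refine ⟨k, hk.le.trans (mul_le_mul' ?_ le_rfl)⟩
      calc (k : ℝ≥0∞) ≤ 2 ^ k := by exact_mod_cast Nat.lt_two_pow_self.le
        _ ≤ _ := pow_le_pow_right₀ (by norm_num) (by omega)
    have hlow : 2 ^ (n + Nat.find hex) * a i ≤ m i := by
      rcases Nat.eq_zero_or_pos (Nat.find hex) with h0 | h0
      · rw [h0, add_zero]
        exact (not_le.1 h).le
      · have := Nat.find_min hex (Nat.sub_one_lt h0.ne')
        rw [add_assoc, Nat.sub_one_add_one h0.ne'] at this
        exact (not_le.1 this).le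
    refine le_trans ?_ (le_add_self.trans (add_le_add_right (ENNReal.le_tsum (Nat.find hex)) _))
    rw [if_pos hlow]
    exact key (Nat.find_spec hex)
  refine (Finset.sum_le_sum hpt).trans ?_
  rw [Finset.sum_add_distrib, ← Finset.mul_sum,
    ← Summable.tsum_finsetSum fun i _ => ENNReal.summable]
  refine add_le_add le_rfl ?_
  have h2 : (2 : ℝ≥0∞) ^ (θ - 1) * 2 = 2 ^ θ := by
    have := ENNReal.rpow_add (x := 2) (θ - 1) 1 (by norm_num) (by norm_num)
    rwa [sub_add_cancel, ENNReal.rpow_one, eq_comm] at this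
  calc ∑' k : ℕ, ∑ i ∈ s, (if 2 ^ (n + k) * a i ≤ m i then (2 ^ (n + k + 1)) ^ θ * a i else 0)
      ≤ ∑' k : ℕ, 2 ^ θ * M * (2 ^ (θ - 1)) ^ n * (2 ^ (θ - 1)) ^ k := by
        refine ENNReal.tsum_le_tsum fun k => ?_
        rw [← Finset.sum_filter, ← Finset.mul_sum]
        have h3 : ((2 : ℝ≥0∞) ^ (n + k + 1)) ^ θ =
            2 ^ θ * (2 ^ (θ - 1)) ^ (n + k) * 2 ^ (n + k) := by
          rw [mul_assoc, ← mul_pow, h2, ← pow_succ', ← ENNReal.rpow_natCast,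
            ← ENNReal.rpow_natCast, ← ENNReal.rpow_mul, ← ENNReal.rpow_mul, mul_comm θ]
        rw [h3]
        calc _ = 2 ^ θ * (2 ^ (θ - 1)) ^ (n + k) *
              (2 ^ (n + k) * ∑ i ∈ s with 2 ^ (n + k) * a i ≤ m i, a i) := by ring
          _ ≤ 2 ^ θ * (2 ^ (θ - 1)) ^ (n + k) * M := by
              gcongr
              exact hM _
          _ = _ := by
              rw [pow_add]
              ring
    _ = _ := by
        rw [ENNReal.tsum_mul_left, ENNReal.tsum_geometric]
        ring

/-- on a complete doubling p-Poincaré space (p > Q = log₂ C_μ) with lower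
mass bound c r^Q ≤ μ(B(x,r)), every u ∈ N^{1,p}_loc(X; V) satisfies the weak
Q-Radó–Reichelderfer condition diam(u(B(x,r)))^Q ≤ C ∫_{B(x,αr)} (1 + g_u^p) dμ for all
sufficiently small balls, g_u a minimal p-weak upper gradient; consequently u is locally
Q-absolutely continuous. -/
theorem stmt_14 {X : Type*} [MetricSpace X] [CompleteSpace X]
    [MeasurableSpace X] [BorelSpace X]
    {V : Type*} [NormedAddCommGroup V] [NormedSpace ℝ V] [CompleteSpace V]
    [MeasurableSpace V] [BorelSpace V]
    (μ : Measure X)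
    (hpos : ∀ (x : X) (r : ℝ), 0 < r → 0 < μ (ball x r) ∧ μ (ball x r) < ∞)
    (Cμ : ℝ) (hCμ : 1 ≤ Cμ)
    (hdoub : ∀ (x : X) (r : ℝ), 0 < r →
      μ (ball x (2 * r)) ≤ ENNReal.ofReal Cμ * μ (ball x r))
    (p : ℝ) (hpQ : Real.logb 2 Cμ < p)
    (CP τ : ℝ) (hCP : 0 < CP) (hτ : 1 ≤ τ) (hPI : WeakPoincare μ p CP τ)
    (c : ℝ) (hc : 0 < c)
    (hLMB : ∀ (x : X) (r : ℝ), 0 < r →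
      ENNReal.ofReal (c * r ^ Real.logb 2 Cμ) ≤ μ (ball x r))
    (u : X → V) (hu : Measurable u)
    (g : X → ℝ≥0∞) (hg : Measurable g)
    (hgu : IsMinimalWeakUpperGradient μ p u g)
    (hNloc : ∀ K : Set X, IsCompact K →
      (∫⁻ x in K, (‖u x‖₊ : ℝ≥0∞) ^ p ∂μ) ≠ ∞ ∧ (∫⁻ x in K, g x ^ p ∂μ) ≠ ∞) :
    ∃ (C : ℝ≥0∞) (α R : ℝ), 0 < C ∧ C ≠ ∞ ∧ 1 ≤ α ∧ 0 < R ∧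
      (∀ (x : X) (r : ℝ), 0 < r → r < R →
        EMetric.diam (u '' ball x r) ^ Real.logb 2 Cμ ≤
          C * ∫⁻ y in ball x (α * r), (1 + g y ^ p) ∂μ) ∧
      (∀ (x₀ : X) (R₀ : ℝ), 0 < R₀ → ∀ ε : ℝ≥0∞, 0 < ε → ∃ δ : ℝ≥0∞, 0 < δ ∧
        ∀ (ι : Type) (t : Finset ι) (cc : ι → X) (ρ : ι → ℝ),
          (∀ i ∈ t, 0 < ρ i ∧ ρ i < R ∧ closedBall (cc i) (ρ i) ⊆ ball x₀ R₀) →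
          ((t : Set ι).Pairwise fun i j =>
            Disjoint (closedBall (cc i) (ρ i)) (closedBall (cc j) (ρ j))) →
          ∑ i ∈ t, μ (closedBall (cc i) (ρ i)) < δ →
          ∑ i ∈ t, EMetric.diam (u '' closedBall (cc i) (ρ i)) ^ Real.logb 2 Cμ < ε) := by
  set Q := Real.logb 2 Cμ
  have hQ : 0 ≤ Q := Real.logb_nonneg (by norm_num) hCμ
  have hp : 0 < p := hQ.trans_lt hpQ
  have hθ : 0 ≤ Q / p := div_nonneg hQ hp.le
  have hθ1 : Q / p < 1 := (div_lt_one hp).2 hpQ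
  have : ProperSpace X := properSpace_of_measure_ball_ge μ (fun x r hr => (hpos x r hr).2)
    fun r hr => ⟨ENNReal.ofReal (c * r ^ Q), ENNReal.ofReal_pos.2 (by positivity),
      fun x => hLMB x r hr⟩
  obtain ⟨C, hC, hdiam⟩ := hgu.1.exists_diam_rpow_le hpos (by linarith) hdoub hQ hpQ hCP hτ hPI hc
    hLMB hg hgu.2.1
  refine ⟨C + 1, 5 * τ, 1, by positivity, by simp [hC], by linarith, one_pos, fun x r hr _ => ?_,
    fun x₀ R₀ _ ε hε => ?_⟩
  · refine (hdiam x r hr).trans (mul_le_mul' le_self_add ?_)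
    set J := ∫⁻ y in ball x (5 * τ * r), (1 + g y ^ p) ∂μ
    have hle : μ (ball x (r / 2)) ≤ J := by
      calc μ (ball x (r / 2)) ≤ μ (ball x (5 * τ * r)) :=
            measure_mono (ball_subset_ball (by nlinarith))
        _ = ∫⁻ y in ball x (5 * τ * r), 1 ∂μ := (setLIntegral_one _).symm
        _ ≤ J := lintegral_mono fun y => le_self_add
    calc μ (ball x (r / 2)) ^ (1 - Q / p) * J ^ (Q / p) ≤ J ^ (1 - Q / p) * J ^ (Q / p) := by
          gcongr
      _ = J := by
          rw [← ENNReal.rpow_add_of_nonneg _ _ (by linarith) hθ, sub_add_cancel, ENNReal.rpow_one]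
  · set ν := μ.withDensity fun y => 1 + g y ^ p with hν
    set κ := 10 * τ
    obtain ⟨k, hk⟩ := pow_unbounded_of_one_lt (5 * κ) (one_lt_two (α := ℝ))
    set D := ENNReal.ofReal Cμ ^ k
    have hD : ∀ (x : X) (r : ℝ), 0 < r →
        μ (closedBall x (5 * (κ * r))) ≤ D * μ (closedBall x r) := by
      intro x r hr
      have hiter : ∀ j : ℕ, μ (ball x (2 ^ j * r)) ≤ ENNReal.ofReal Cμ ^ j * μ (ball x r) := by
        intro j
        induction j with
        | zero => simp
        | succ j ih =>
          rw [pow_succ', pow_succ', mul_assoc, mul_assoc]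
          exact (hdoub x _ (by positivity)).trans (mul_le_mul' le_rfl ih)
      calc μ (closedBall x (5 * (κ * r))) ≤ μ (ball x (2 ^ k * r)) :=
            measure_mono (closedBall_subset_ball (by nlinarith))
        _ ≤ D * μ (ball x r) := hiter k
        _ ≤ D * μ (closedBall x r) := by
            gcongr
            exact ball_subset_closedBall
    set W := ball x₀ (R₀ + κ)
    have hWfin : ν W ≠ ∞ := by
      rw [hν, withDensity_apply _ measurableSet_ball, lintegral_add_left measurable_const,
        setLIntegral_one]
      refine ENNReal.add_ne_top.2 ⟨?_, ne_top_of_le_ne_top hgu.2.1 (setLIntegral_le_lintegral _ _)⟩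
      exact ((measure_mono (ball_subset_ball (le_max_left _ 1))).trans_lt
        (hpos x₀ (max (R₀ + κ) 1) (by positivity)).2).ne
    set M := D * ν W
    have hM : M ≠ ∞ := ENNReal.mul_ne_top (ENNReal.pow_ne_top ENNReal.ofReal_ne_top) hWfin
    set ε' := min ε 1
    have hε' : ε' / 2 ≠ 0 := (ENNReal.half_pos (lt_min hε one_pos).ne').ne'
    have hε't : ε' / 2 ≠ ∞ :=
      ENNReal.div_ne_top (ne_top_of_le_ne_top ENNReal.one_ne_top (min_le_right _ _)) (by simp)
    have hx : (2 : ℝ≥0∞) ^ (Q / p - 1) < 1 :=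
      ENNReal.rpow_lt_one_of_one_lt_of_neg (by norm_num) (by linarith)
    obtain ⟨n, hn⟩ : ∃ n : ℕ, C * (2 ^ (Q / p) * M * ((2 ^ (Q / p - 1)) ^ n *
        (1 - 2 ^ (Q / p - 1))⁻¹)) < ε' / 2 := by
      have hlim := ENNReal.Tendsto.const_mul (a := C * (2 ^ (Q / p) * M) * (1 - 2 ^ (Q / p - 1))⁻¹)
        (ENNReal.tendsto_pow_atTop_nhds_zero_of_lt_one hx) (Or.inr (by
          refine ENNReal.mul_ne_top (ENNReal.mul_ne_top hC (ENNReal.mul_ne_top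
            (ENNReal.rpow_ne_top_of_nonneg hθ (by simp)) hM)) ?_
          exact ENNReal.inv_ne_top.2 (tsub_pos_of_lt hx).ne'))
      rw [mul_zero] at hlim
      obtain ⟨n, hn⟩ := (hlim.eventually_lt_const hε'.bot_lt).exists
      refine ⟨n, lt_of_eq_of_lt ?_ hn⟩
      ring
    set L := C * (2 ^ n) ^ (Q / p)
    have hL : L ≠ ∞ := ENNReal.mul_ne_top hC
      (ENNReal.rpow_ne_top_of_nonneg hθ (ENNReal.pow_ne_top (by simp)))
    refine ⟨ε' / 2 / (L + 1), ENNReal.div_pos hε' (by simp [hL]),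
      fun ι t cc ρ hball hdisj hsum => ?_⟩
    have hW : ∀ i ∈ t, closedBall (cc i) (κ * ρ i) ⊆ W := by
      intro i hi
      obtain ⟨h0, h1, hsub⟩ := hball i hi
      have := mem_ball.1 (hsub (mem_closedBall_self h0.le))
      exact closedBall_subset_ball' (by nlinarith)
    have hterm : ∀ i ∈ t, ediam (u '' closedBall (cc i) (ρ i)) ^ Q ≤
        C * (μ (closedBall (cc i) (ρ i)) ^ (1 - Q / p) *
          ν (closedBall (cc i) (κ * ρ i)) ^ (Q / p)) := by
      intro i hi
      have h0 := (hball i hi).1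
      calc ediam (u '' closedBall (cc i) (ρ i)) ^ Q
          ≤ ediam (u '' ball (cc i) (2 * ρ i)) ^ Q := by
            gcongr
            exact closedBall_subset_ball (by linarith)
        _ ≤ _ := hdiam (cc i) (2 * ρ i) (by positivity)
        _ ≤ _ := by
            rw [hν, withDensity_apply _ measurableSet_closedBall,
              mul_div_cancel_left₀ _ (two_ne_zero' ℝ)]
            gcongr
            · exact ball_subset_closedBall
            · exact ball_subset_closedBall.trans
                (closedBall_subset_closedBall (le_of_eq (by simp only [κ]; ring)))
    have hweak := sum_rpow_mul_rpow_le (s := t) (a := fun i => μ (closedBall (cc i) (ρ i)))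
      (m := fun i => ν (closedBall (cc i) (κ * ρ i))) (M := M) hθ hθ1
      (fun i hi => ((hpos _ _ (hball i hi).1).1.trans_le
        (measure_mono ball_subset_closedBall)).ne')
      (fun i hi => ne_top_of_le_ne_top hWfin (measure_mono (hW i hi)))
      (fun s => by
        have hmem : ∀ i ∈ t.filter fun i => s * μ (closedBall (cc i) (ρ i)) ≤
            ν (closedBall (cc i) (κ * ρ i)), i ∈ t := fun i hi => (Finset.mem_filter.1 hi).1
        exact mul_sum_measure_closedBall_le (fun i hi => (hball i (hmem i hi)).1.le)
          (by linarith) (fun i hi j hj hij => hdisj (hmem i hi) (hmem j hj) hij)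
          (fun i hi => hD _ _ (hball i (hmem i hi)).1) (fun i hi => hW i (hmem i hi))
          (fun i hi => (Finset.mem_filter.1 hi).2)) n
    calc ∑ i ∈ t, ediam (u '' closedBall (cc i) (ρ i)) ^ Q
        ≤ C * ∑ i ∈ t, μ (closedBall (cc i) (ρ i)) ^ (1 - Q / p) *
            ν (closedBall (cc i) (κ * ρ i)) ^ (Q / p) := by
          rw [Finset.mul_sum]
          exact Finset.sum_le_sum hterm
      _ ≤ L * ∑ i ∈ t, μ (closedBall (cc i) (ρ i)) + C * (2 ^ (Q / p) * M *
            ((2 ^ (Q / p - 1)) ^ n * (1 - 2 ^ (Q / p - 1))⁻¹)) := by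
          refine (mul_le_mul' le_rfl hweak).trans (le_of_eq ?_)
          rw [mul_add, ← mul_assoc]
      _ < ε' / 2 + ε' / 2 := by
          have hle : L * ∑ i ∈ t, μ (closedBall (cc i) (ρ i)) ≤ ε' / 2 := by
            calc L * ∑ i ∈ t, μ (closedBall (cc i) (ρ i)) ≤ (L + 1) * (ε' / 2 / (L + 1)) :=
                  mul_le_mul' le_self_add hsum.le
              _ ≤ ε' / 2 := ENNReal.mul_div_le
          exact ENNReal.add_lt_add_of_le_of_lt (ne_top_of_le_ne_top hε't hle) hle hn
      _ = ε' := ENNReal.add_halves _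
      _ ≤ ε := min_le_left _ _
end
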